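/- Let W : [0,1]² → [0,1] be Lebesgue-measurable with W(x,y) = W(y,x) for a.e. (x,y) ∈ [0,1]². If there exist f, g ∈ L²[0,1] with ‖f‖₂ = ‖g‖₂ = 1 such that ∫₀¹∫₀¹ W(x,y)·(f(x)f(y) − g(x)g(y)) dx dy = 2/√3, then there exists a Lebesgue-measure-preserving measurable map σ : [0,1] → [0,1] such that for a.e. (x,y) ∈ [0,1]²: W(σ(x),σ(y)) = 0 if (x,y) ∈ [2/3,1]×[2/3,1], and W(σ(x),σ(y)) = 1 otherwise. -/

import Mathlib

open MeasureTheory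

/-- Lebesgue measure restricted to the unit square `[0,1]²`. -/
noncomputable def unitSq : Measure (ℝ × ℝ) :=
  volume.restrict (Set.Icc (0 : ℝ) 1 ×ˢ Set.Icc (0 : ℝ) 1)

/-- Lebesgue measure restricted to the unit interval `[0,1]`. -/
noncomputable def unitInt : Measure ℝ := volume.restrict (Set.Icc (0 : ℝ) 1)

/-- A graphon: a measurable function with values in `[0,1]` which is symmetric
almost everywhere on `[0,1]²`. -/
def IsGraphon (W : ℝ → ℝ → ℝ) : Prop :=
  Measurable (Function.uncurry W) ∧ (∀ x y, W x y ∈ Set.Icc (0 : ℝ) 1) ∧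
    (∀ᵐ p : ℝ × ℝ ∂unitSq, W p.1 p.2 = W p.2 p.1)

/-- A unit function of `L²[0,1]`: measurable with `∫₀¹ f² = 1`. -/
def IsUnitL2 (f : ℝ → ℝ) : Prop :=
  Measurable f ∧ (∫ x in Set.Icc (0 : ℝ) 1, (f x) ^ 2) = 1

/-- The quadratic form `∫₀¹∫₀¹ W(x,y) f(x) f(y) dx dy`. -/
noncomputable def quadForm (W : ℝ → ℝ → ℝ) (f : ℝ → ℝ) : ℝ :=
  ∫ x in Set.Icc (0 : ℝ) 1, ∫ y in Set.Icc (0 : ℝ) 1, W x y * f x * f y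

/-- `μ(W)`, the maximum eigenvalue of the kernel operator associated to `W`. -/
noncomputable def graphonMu (W : ℝ → ℝ → ℝ) : ℝ :=
  sSup {r : ℝ | ∃ f : ℝ → ℝ, IsUnitL2 f ∧ r = quadForm W f}

/-- `ν(W)`, the minimum eigenvalue of the kernel operator associated to `W`. -/
noncomputable def graphonNu (W : ℝ → ℝ → ℝ) : ℝ :=
  sInf {r : ℝ | ∃ f : ℝ → ℝ, IsUnitL2 f ∧ r = quadForm W f}

/-- The spread `spr(W) = μ(W) − ν(W)` of a graphon. -/
noncomputable def graphonSpr (W : ℝ → ℝ → ℝ) : ℝ := graphonMu W - graphonNu W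

/-- `f` is a `lam`-eigenfunction of the kernel operator of `W`. -/
def IsEigenfunction (W : ℝ → ℝ → ℝ) (lam : ℝ) (f : ℝ → ℝ) : Prop :=
  ∀ᵐ x ∂unitInt, (∫ y in Set.Icc (0 : ℝ) 1, W x y * f y) = lam * f x

open Finset in
lemma prob_bound {ι : Type*} [Fintype ι] (π T : ι → ℝ) (hπ : ∀ j, 0 ≤ π j) (h1 : ∑ j, π j = 1)
    (x θ z : ℝ) (hx : x = ∑ j, π j * T j) (hθ : θ = ∑ j, π j * (T j - x) ^ 2)
    (hz : θ * z = ∑ j, π j * ((T j - x) ^ 2 * T j)) (hz0 : θ = 0 → z = 0) :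
    x ^ 2 + 2 * θ + z ^ 2 ≤ ∑ j, T j ^ 2 := by
  have hθ0 : 0 ≤ θ := by rw [hθ]; exact sum_nonneg fun j _ => mul_nonneg (hπ j) (sq_nonneg _)
  have hd : ∑ j, π j * (T j - x) = 0 := by
    simp only [mul_sub, sum_sub_distrib, ← sum_mul, h1, ← hx]; ring
  have hT2 : ∑ j, π j * T j ^ 2 = x ^ 2 + θ := by
    have : ∑ j, π j * T j ^ 2 = ∑ j, (π j * (T j - x) ^ 2 + 2 * x * (π j * (T j - x)) + x ^ 2 * π j) :=
      sum_congr rfl fun j _ => by ring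
    rw [this, sum_add_distrib, sum_add_distrib, ← mul_sum, ← mul_sum, hd, h1, ← hθ]; ring
  have hπ1 : ∀ j, π j ≤ 1 := fun j => by
    rw [← h1]; exact single_le_sum (f := π) (fun i _ => hπ i) (mem_univ j)
  rcases hθ0.eq_or_lt with h | h
  · rw [hz0 h.symm, ← h]
    have : ∑ j, π j * T j ^ 2 ≤ ∑ j, T j ^ 2 :=
      sum_le_sum fun j _ => mul_le_of_le_one_left (sq_nonneg _) (hπ1 j)
    rw [hT2, ← h] at this
    simpa using this
  · -- key pointwise bound
    have key : ∀ j, π j * (θ + (T j - x) ^ 2) ≤ θ := by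
      intro j
      by_cases hdj : T j - x = 0
      · rw [hdj]; nlinarith [hπ1 j]
      · have hc : ∀ c : ℝ, π j * ((T j - x) + c) ^ 2 ≤ θ + c ^ 2 := by
          intro c
          have e : ∑ i, π i * ((T i - x) + c) ^ 2 = θ + c ^ 2 := by
            have : ∑ i, π i * ((T i - x) + c) ^ 2
              = ∑ i, (π i * (T i - x) ^ 2 + 2 * c * (π i * (T i - x)) + c ^ 2 * π i) :=
              sum_congr rfl fun i _ => by ring
            rw [this, sum_add_distrib, sum_add_distrib, ← mul_sum, ← mul_sum, hd, h1, ← hθ]; ring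
          rw [← e]
          exact single_le_sum (f := fun i => π i * ((T i - x) + c) ^ 2)
            (fun i _ => mul_nonneg (hπ i) (sq_nonneg _)) (mem_univ j)
        have hcc := hc (θ / (T j - x))
        set d := T j - x
        have hd2 : 0 < d ^ 2 := by positivity
        have e1 : d ^ 2 * (π j * (d + θ / d) ^ 2) ≤ d ^ 2 * (θ + (θ / d) ^ 2) :=
          mul_le_mul_of_nonneg_left hcc hd2.le
        have e2 : d ^ 2 * (π j * (d + θ / d) ^ 2) = (θ + d ^ 2) * (π j * (θ + d ^ 2)) := by
          field_simp; ring
        have e3 : d ^ 2 * (θ + (θ / d) ^ 2) = (θ + d ^ 2) * θ := by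
          field_simp; ring
        rw [e2, e3] at e1
        exact le_of_mul_le_mul_left e1 (by positivity)
    have h3 : ∑ j, π j * ((T j - x) * T j) = θ := by
      have : ∑ j, π j * ((T j - x) * T j) = ∑ j, (π j * (T j - x) ^ 2 + x * (π j * (T j - x))) :=
        sum_congr rfl fun j _ => by ring
      rw [this, sum_add_distrib, ← mul_sum, hd, ← hθ]; ring
    have h4 : θ * (θ + z ^ 2) ≤ ∑ j, π j * ((T j - x) ^ 2 * T j ^ 2) := by
      have h0 : 0 ≤ ∑ j, π j * ((T j - x) * T j - θ - z * (T j - x)) ^ 2 :=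
        sum_nonneg fun j _ => mul_nonneg (hπ j) (sq_nonneg _)
      have e : ∑ j, π j * ((T j - x) * T j - θ - z * (T j - x)) ^ 2
        = ∑ j, (π j * ((T j - x) ^ 2 * T j ^ 2) - 2 * θ * (π j * ((T j - x) * T j))
           - 2 * z * (π j * ((T j - x) ^ 2 * T j)) + θ ^ 2 * π j + z ^ 2 * (π j * (T j - x) ^ 2)
           + 2 * θ * z * (π j * (T j - x))) := sum_congr rfl fun j _ => by ring
      rw [e] at h0
      simp only [sum_add_distrib, sum_sub_distrib, ← mul_sum] at h0
      rw [h3, ← hz, h1, ← hθ, hd] at h0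
      nlinarith
    have h5 : θ * (∑ j, π j * T j ^ 2) + ∑ j, π j * ((T j - x) ^ 2 * T j ^ 2) ≤ θ * ∑ j, T j ^ 2 := by
      rw [mul_sum, mul_sum, ← sum_add_distrib]
      refine sum_le_sum fun j _ => ?_
      nlinarith [mul_le_mul_of_nonneg_right (key j) (sq_nonneg (T j))]
    rw [hT2] at h5
    have : θ * (x ^ 2 + 2 * θ + z ^ 2) ≤ θ * ∑ j, T j ^ 2 := by nlinarith
    exact le_of_mul_le_mul_left this h

lemma core_y_pos (t y ρ : ℝ) (ht : 0 < t) (ht1 : t ≤ 1) (hy : 0 < y) (hρ : 0 ≤ ρ) (hxt : y + ρ < t)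
    (h1 : y ^ 2 + 3 * (t - 1/3) ^ 2 ≤ ρ ^ 2 / 2)
    (h2 : 4 * ρ * t ≤ 2 * y * (1 - t) - 3 * y ^ 2 - 3 * (t - 1/3)^2 + ρ ^ 2) : False := by
  by_cases h : (262/1000 : ℝ) ≤ t
  · -- ρ ≥ √2 y ≥ 1.414 y
    have hr : (1414/1000 : ℝ) * y ≤ ρ := by
      by_contra hc
      push Not at hc
      nlinarith [sq_nonneg (t - 1/3)]
    nlinarith [sq_nonneg (t - 1/3), mul_pos hy ht, mul_nonneg hy.le (sub_nonneg.2 hr), mul_nonneg (sub_nonneg.2 hr) (by linarith : 0 ≤ 4 * t - ρ - (1414/1000) * y)]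
  · push Not at h
    have hr : (174/1000 : ℝ) ≤ ρ := by
      by_contra hc
      push Not at hc
      nlinarith [sq_nonneg y]
    have ht2 : (23/100 : ℝ) ≤ t := by
      by_contra hc
      push Not at hc
      nlinarith [sq_nonneg y]
    nlinarith [mul_nonneg (by linarith : (0:ℝ) ≤ ρ - 174/1000) (by linarith : 0 ≤ t - y - ρ), sq_nonneg (t-1/3), mul_pos hy ht]

lemma core_ineq (t x ρ z μ s v q : ℝ) (ht : 0 < t) (ht1 : t ≤ 1) (hx : x < t) (hρ : 0 ≤ ρ)
    (hq : q = μ - s) (hq2 : q = 1 - t - x + ρ) (hB : μ * s ≤ t * (q + x))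
    (hA : t ^ 2 + x ^ 2 + 2 * ρ * (t - x) + z ^ 2 ≤ v)
    (hv : v = t ^ 2 + t * x + x ^ 2 - ρ * (z + 2 * x) + q - q ^ 2 - μ * s)
    (hS : 4 / 3 ≤ (μ + s) ^ 2) : t = 1 / 3 ∧ v = 1 / 9 := by
  obtain ⟨y, hy⟩ : ∃ y, y = x - ρ := ⟨_, rfl⟩
  obtain rfl : x = y + ρ := by linarith
  have hS2 : (μ + s) ^ 2 = q ^ 2 + 4 * (μ * s) := by rw [hq]; ring
  have hA' : 4/3 ≤ 1 + 2 * t - 3 * t ^ 2 + 2 * y * (1 - t) - 3 * y ^ 2 - 4 * ρ * t - 4 * (z * (z + ρ)) := by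
    have : q = 1 - t - y := by linarith
    subst this
    nlinarith
  have hB' : 4/3 ≤ 1 + 2 * t - 3 * t ^ 2 - 2 * y * (1 - t) + y ^ 2 + 4 * t * ρ := by
    have : q = 1 - t - y := by linarith
    subst this
    nlinarith
  have hz : - 4 * (z * (z + ρ)) ≤ ρ ^ 2 := by nlinarith [sq_nonneg (2 * z + ρ)]
  rcases lt_or_ge 0 y with hy0 | hy0
  · exfalso
    exact core_y_pos t y ρ ht ht1 hy0 hρ hx (by nlinarith) (by nlinarith)
  · have hρ4 : ρ ≤ 4 * t := by
      by_contra hc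
      push Not at hc
      have : ρ * (ρ - 4 * t) ≤ (t - y) * (- y - 3 * t) := by
        apply mul_le_mul <;> linarith
      nlinarith [mul_nonneg (neg_nonneg.2 hy0) (sub_nonneg.2 ht1), sq_nonneg (t - 1/3)]
    have e1 : 0 ≤ ρ * (4 * t - ρ) := mul_nonneg hρ (by linarith)
    have e2 : 0 ≤ (-y) * (1 - t) := mul_nonneg (by linarith) (by linarith)
    have t13 : t = 1/3 := by
      have : (t - 1/3)^2 ≤ 0 := by nlinarith [sq_nonneg y]
      have : t - 1/3 = 0 := by simpa using le_antisymm this (sq_nonneg _)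
      linarith
    have y0 : y = 0 := by
      have : y^2 ≤ 0 := by nlinarith [sq_nonneg (t-1/3)]
      simpa using le_antisymm this (sq_nonneg _)
    subst t13 y0
    have ρ0 : ρ = 0 := by
      rcases hρ.eq_or_lt with h | h
      · exact h.symm
      · exfalso; nlinarith
    subst ρ0
    have z0 : z = 0 := by
      have : z^2 ≤ 0 := by nlinarith
      simpa using le_antisymm this (sq_nonneg _)
    subst z0
    refine ⟨rfl, ?_⟩
    have : q = 2/3 := by linarith
    subst this
    nlinarith
set_option maxHeartbeats 1000000 in
open Finset in
lemma eig_case {ι : Type*} [Fintype ι] [DecidableEq ι] (o : ι) (T φ γ ρ : ι → ℝ) (μ s A B : ℝ)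
    (hφ : ∀ j, (μ + T j) * φ j = A * ρ j) (hγ : ∀ j, (T j - s) * γ j = B * ρ j)
    (hA : A = ∑ j, φ j * ρ j) (hB : B = ∑ j, γ j * ρ j) (hρ : ∑ j, ρ j ^ 2 = 1)
    (hAB : 0 < A * B) (hw : T o ≤ ρ o ^ 2) (hHS : ∑ j, T j ^ 2 ≤ ∑ j, T j * ρ j ^ 2)
    (hTs : ∀ j, j ≠ o → T j ≤ s) (hTμ : ∀ j, 0 ≤ μ + T j) (hs : 0 < s) (hst : s ≤ T o)
    (hμ : 0 < μ) (hS : 4 / 3 ≤ (μ + s) ^ 2) :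
    T o = 1 / 3 ∧ ∑ j, T j * ρ j ^ 2 = 1 / 9 := by
  have c0 : ∑ j, φ j * γ j = 0 := by
    have : (μ + s) * ∑ j, φ j * γ j = 0 := by
      have : (μ + s) * ∑ j, φ j * γ j = ∑ j, (A * (γ j * ρ j) - B * (φ j * ρ j)) := by
        rw [mul_sum]; refine sum_congr rfl fun j _ => ?_
        linear_combination (γ j) * hφ j - φ j * hγ j
      rw [this, sum_sub_distrib, ← mul_sum, ← mul_sum, ← hA, ← hB]; ring
    rcases mul_eq_zero.1 this with h | h
    · linarith
    · exact h
  have c1 : ∑ j, T j * (φ j * γ j) = A * B := by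
    have : ∑ j, T j * (φ j * γ j) = ∑ j, (A * (γ j * ρ j) - μ * (φ j * γ j)) :=
      sum_congr rfl fun j _ => by linear_combination (γ j) * hφ j
    rw [this, sum_sub_distrib, ← mul_sum, ← mul_sum, c0, ← hB]; ring
  have pw : ∀ j, (μ + T j) * (T j - s) * (φ j * γ j) = A * B * ρ j ^ 2 := fun j => by
    linear_combination ((T j - s) * γ j) * hφ j + A * ρ j * hγ j
  have c2 : ∑ j, T j ^ 2 * (φ j * γ j) = A * B * (1 - (μ - s)) := by
    have : ∑ j, T j ^ 2 * (φ j * γ j)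
      = ∑ j, (A * B * ρ j ^ 2 - (μ - s) * (T j * (φ j * γ j)) + μ * s * (φ j * γ j)) :=
      sum_congr rfl fun j _ => by linear_combination pw j
    rw [this, sum_add_distrib, sum_sub_distrib, ← mul_sum, ← mul_sum, ← mul_sum, c0, c1, hρ]; ring
  set v := ∑ j, T j * ρ j ^ 2 with hv
  have c3 : ∑ j, T j ^ 3 * (φ j * γ j) = A * B * (v - (μ - s) * (1 - (μ - s)) + μ * s) := by
    have : ∑ j, T j ^ 3 * (φ j * γ j)
      = ∑ j, (A * B * (T j * ρ j ^ 2) - (μ - s) * (T j ^ 2 * (φ j * γ j))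
          + μ * s * (T j * (φ j * γ j))) :=
      sum_congr rfl fun j _ => by linear_combination T j * pw j
    rw [this, sum_add_distrib, sum_sub_distrib, ← mul_sum, ← mul_sum, ← mul_sum, c1, c2, ← hv]; ring
  set t := T o with ht
  set M := φ o * γ o with hM
  have htpos : 0 < t := by linarith
  have ht1 : t ≤ 1 := by
    have : ρ o ^ 2 ≤ ∑ j, ρ j ^ 2 := single_le_sum (f := fun j => ρ j ^ 2) (fun i _ => sq_nonneg _) (mem_univ o)
    linarith
  -- t > s and M > 0
  have hpo := pw o
  rw [← ht, ← hM] at hpo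
  have hR : 0 < A * B * ρ o ^ 2 := mul_pos hAB (by linarith)
  have hts : 0 < (μ + t) * (t - s) := by
    rcases (mul_nonneg (by linarith : 0 ≤ μ + t) (by linarith : 0 ≤ t - s)).eq_or_lt with h | h
    · rw [← h] at hpo; linarith
    · exact h
  have hMpos : 0 < M := by
    by_contra hc
    push Not at hc
    nlinarith
  -- weights
  obtain ⟨π, hπ⟩ : ∃ π : ι → ℝ, π = fun j => if j = o then 0 else -(φ j * γ j) / M := ⟨_, rfl⟩
  have hπ0 : ∀ j, 0 ≤ π j := by
    intro j
    rw [hπ]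
    by_cases hj : j = o
    · simp [hj]
    · simp only [hj, if_false]
      refine div_nonneg ?_ hMpos.le
      by_contra hc
      push Not at hc
      have hpos : 0 < φ j * γ j := by linarith
      have h1 := pw j
      have h2 : 0 ≤ A * B * ρ j ^ 2 := mul_nonneg hAB.le (sq_nonneg _)
      have h3 : (μ + T j) * (T j - s) ≤ 0 := mul_nonpos_of_nonneg_of_nonpos (hTμ j) (by linarith [hTs j hj])
      have h4 : A * B * ρ j ^ 2 = 0 := by nlinarith
      have h5 : ρ j = 0 := by
        rcases mul_eq_zero.1 h4 with h | h
        · linarith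
        · simpa using h
      have h6 := hφ j
      have h7 := hγ j
      rw [h5, mul_zero] at h6 h7
      have hφ0 : φ j ≠ 0 := by rintro h; rw [h] at hpos; simp at hpos
      have hγ0 : γ j ≠ 0 := by rintro h; rw [h] at hpos; simp at hpos
      have h8 : μ + T j = 0 := by simpa [hφ0] using h6
      have h9 : T j - s = 0 := by simpa [hγ0] using h7
      linarith
  have trans : ∀ F : ι → ℝ, ∑ j, π j * F j = (F o * M - ∑ j, F j * (φ j * γ j)) / M := by
    intro F
    rw [eq_div_iff hMpos.ne', sum_mul, ← sum_erase_add _ _ (mem_univ o),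
      ← sum_erase_add _ (fun j => F j * (φ j * γ j)) (mem_univ o)]
    have : ∀ j ∈ univ.erase o, π j * F j * M = - (F j * (φ j * γ j)) := by
      intro j hj
      have hj : j ≠ o := (mem_erase.1 hj).1
      rw [hπ]; simp only [hj, if_false]; field_simp
    rw [sum_congr rfl this, hπ, sum_neg_distrib]
    simp only [if_true]
    rw [hM]; ring
  have hπ1 : ∑ j, π j = 1 := by
    have := trans (fun _ => 1)
    simp only [mul_one, one_mul, c0] at this
    rw [this, sub_zero, div_self hMpos.ne']
  obtain ⟨D, hD⟩ : ∃ D, D = A * B / M := ⟨_, rfl⟩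
  have hDM : A * B = D * M := by rw [hD]; field_simp
  have hDpos : 0 < D := by rw [hD]; positivity
  obtain ⟨T', hT'⟩ : ∃ T' : ι → ℝ, T' = fun j => if j = o then 0 else T j := ⟨_, rfl⟩
  have hTT : ∀ (G : ℝ → ℝ), ∑ j, π j * G (T' j) = ∑ j, π j * G (T j) := by
    intro G
    refine sum_congr rfl fun j _ => ?_
    by_cases hj : j = o
    · simp [hπ, hj]
    · simp [hT', hj]
  obtain ⟨x, hx⟩ : ∃ x, x = ∑ j, π j * T' j := ⟨_, rfl⟩
  have hx1 : x = t - D := by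
    rw [hx, hTT (fun y => y), trans, c1, hDM, ← ht]; field_simp
  have hm2 : ∑ j, π j * T' j ^ 2 = t ^ 2 - D * (1 - (μ - s)) := by
    rw [hTT (fun y => y ^ 2), trans, c2, hDM, ← ht]; field_simp
  have hm3 : ∑ j, π j * T' j ^ 3 = t ^ 3 - D * (v - (μ - s) * (1 - (μ - s)) + μ * s) := by
    rw [hTT (fun y => y ^ 3), trans, c3, hDM, ← ht]; field_simp
  obtain ⟨θ, hθ⟩ : ∃ θ, θ = ∑ j, π j * (T' j - x) ^ 2 := ⟨_, rfl⟩
  have hθ1 : θ = t ^ 2 - D * (1 - (μ - s)) - x ^ 2 := by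
    have : ∑ j, π j * (T' j - x) ^ 2 = ∑ j, (π j * T' j ^ 2 - 2 * x * (π j * T' j) + x ^ 2 * π j) :=
      sum_congr rfl fun j _ => by ring
    rw [hθ, this, sum_add_distrib, sum_sub_distrib, ← mul_sum, ← mul_sum, hm2, ← hx, hπ1]; ring
  have hθ0 : 0 ≤ θ := by rw [hθ]; exact sum_nonneg fun j _ => mul_nonneg (hπ0 j) (sq_nonneg _)
  obtain ⟨κ, hκ⟩ : ∃ κ, κ = ∑ j, π j * ((T' j - x) ^ 2 * T' j) := ⟨_, rfl⟩
  have hκ1 : κ = t ^ 3 - D * (v - (μ - s) * (1 - (μ - s)) + μ * s) - 2 * x * (θ + x ^ 2) + x ^ 3 := by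
    have : ∑ j, π j * ((T' j - x) ^ 2 * T' j)
       = ∑ j, (π j * T' j ^ 3 - 2 * x * (π j * T' j ^ 2) + x ^ 2 * (π j * T' j)) :=
      sum_congr rfl fun j _ => by ring
    rw [hκ, this, sum_add_distrib, sum_sub_distrib, ← mul_sum, ← mul_sum, hm3, hm2, ← hx, hθ1]; ring
  obtain ⟨z, hz, hz0⟩ : ∃ z, θ * z = κ ∧ (θ = 0 → z = 0) := by
    by_cases h : θ = 0
    · refine ⟨0, ?_, fun _ => rfl⟩
      rw [mul_zero, hκ]
      symm
      have hall := (sum_eq_zero_iff_of_nonneg (fun j _ => mul_nonneg (hπ0 j) (sq_nonneg (T' j - x)))).1 (hθ.symm.trans h)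
      refine sum_eq_zero fun j hj => ?_
      rw [← mul_assoc, hall j hj, zero_mul]
    · exact ⟨κ / θ, by field_simp, fun h' => absurd h' h⟩
  have hpb := prob_bound π T' hπ0 hπ1 x θ z hx hθ (hz.trans hκ) hz0
  have hN : ∑ j, T' j ^ 2 = ∑ j, T j ^ 2 - t ^ 2 := by
    rw [← sum_erase_add _ _ (mem_univ o), ← sum_erase_add _ (fun j => T j ^ 2) (mem_univ o)]
    have : ∀ j ∈ univ.erase o, T' j ^ 2 = T j ^ 2 := by
      intro j hj
      have hj : j ≠ o := (mem_erase.1 hj).1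
      simp [hT', hj]
    rw [sum_congr rfl this]
    simp [hT', ht]
  have hwB : t * D ≤ (μ + t) * (t - s) := by
    have h1 : t * D * M ≤ (μ + t) * (t - s) * M := by
      have h2 := mul_le_mul_of_nonneg_left hw hAB.le
      have h3 : t * D * M = A * B * t := by rw [hDM]; ring
      linarith
    exact le_of_mul_le_mul_right h1 hMpos
  have hr : θ / D * D = θ := div_mul_cancel₀ _ hDpos.ne'
  obtain ⟨r, hr'⟩ : ∃ r, r = θ / D := ⟨_, rfl⟩
  rw [← hr'] at hr
  have hr0 : 0 ≤ r := by rw [hr']; positivity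
  have hDx : D = t - x := by linarith
  have hq2 : μ - s = 1 - t - x + r := by
    have : D * (μ - s) = D * (1 - t - x + r) := by
      have hD2 : D * (t + x) = t ^ 2 - x ^ 2 := by rw [hDx]; ring
      linear_combination -hθ1 - hr + hD2
    exact mul_left_cancel₀ hDpos.ne' this
  refine core_ineq t x r z μ s v (μ - s) htpos ht1 (by linarith) hr0 rfl hq2 ?_ ?_ ?_ hS
  · have hD3 : t * D = t * (t - x) := by rw [hDx]
    linarith
  · rw [← hDx, mul_assoc, hr]; linarith
  · have : D * v = D * (t ^ 2 + t * x + x ^ 2 - r * (z + 2 * x) + (μ - s) - (μ - s) ^ 2 - μ * s) := by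
      have e1 : D * (r * (z + 2 * x)) = κ + 2 * x * θ := by rw [← hz, ← hr]; ring
      have e2 : D * (t ^ 2 + t * x + x ^ 2) = t ^ 3 - x ^ 3 := by rw [hDx]; ring
      linear_combination e1 - e2 + hκ1
    exact mul_left_cancel₀ hDpos.ne' this

open Finset in
lemma crit_lemma {ι : Type*} [Fintype ι] [DecidableEq ι] (T ρ φ : ι → ℝ) (a b c : ℝ)
    (h0 : ∀ u : ι → ℝ, 0 ≤ a * ∑ j, u j ^ 2 + b * (∑ j, u j * ρ j) ^ 2 + c * ∑ j, T j * u j ^ 2)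
    (h1 : a * ∑ j, φ j ^ 2 + b * (∑ j, φ j * ρ j) ^ 2 + c * ∑ j, T j * φ j ^ 2 = 0) (j : ι) :
    a * φ j + b * (∑ j, φ j * ρ j) * ρ j + c * (T j * φ j) = 0 := by
  have key : ∀ ε : ℝ, 0 ≤ 2 * ε * (a * φ j + b * (∑ j, φ j * ρ j) * ρ j + c * (T j * φ j))
      + ε ^ 2 * (a + b * ρ j ^ 2 + c * T j) := by
    intro ε
    have h := h0 (fun i => φ i + ε * (if i = j then 1 else 0))
    have e1 : ∑ i, (φ i + ε * (if i = j then 1 else 0)) ^ 2 = ∑ i, φ i ^ 2 + 2 * ε * φ j + ε ^ 2 := by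
      have : ∀ i, (φ i + ε * (if i = j then 1 else 0)) ^ 2
        = φ i ^ 2 + (if i = j then 2 * ε * φ i + ε ^ 2 else 0) := fun i => by split_ifs <;> ring
      simp only [this, sum_add_distrib, sum_ite_eq', mem_univ, if_true]; ring
    have e2 : ∑ i, (φ i + ε * (if i = j then 1 else 0)) * ρ i = ∑ i, φ i * ρ i + ε * ρ j := by
      have : ∀ i, (φ i + ε * (if i = j then 1 else 0)) * ρ i
        = φ i * ρ i + (if i = j then ε * ρ i else 0) := fun i => by split_ifs <;> ring
      simp only [this, sum_add_distrib, sum_ite_eq', mem_univ, if_true]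
    have e3 : ∑ i, T i * (φ i + ε * (if i = j then 1 else 0)) ^ 2
        = ∑ i, T i * φ i ^ 2 + 2 * ε * (T j * φ j) + ε ^ 2 * T j := by
      have : ∀ i, T i * (φ i + ε * (if i = j then 1 else 0)) ^ 2
        = T i * φ i ^ 2 + (if i = j then 2 * ε * (T i * φ i) + ε ^ 2 * T i else 0) :=
        fun i => by split_ifs <;> ring
      simp only [this, sum_add_distrib, sum_ite_eq', mem_univ, if_true]; ring
    rw [e1, e2, e3] at h
    linarith
  generalize a * φ j + b * (∑ j, φ j * ρ j) * ρ j + c * (T j * φ j) = p at key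
  generalize a + b * ρ j ^ 2 + c * T j = d at key
  by_contra hp
  have hp2 : 0 < p ^ 2 := by positivity
  have h := key (-p / (|d| + 1))
  have hd : 0 < |d| + 1 := by positivity
  have e : 2 * (-p / (|d| + 1)) * p + (-p / (|d| + 1)) ^ 2 * d
      = p ^ 2 * (d - 2 * (|d| + 1)) / (|d| + 1) ^ 2 := by field_simp; ring
  rw [e] at h
  have h2 : p ^ 2 * (d - 2 * (|d| + 1)) / (|d| + 1) ^ 2 < 0 := by
    apply div_neg_of_neg_of_pos _ (by positivity)
    apply mul_neg_of_pos_of_neg hp2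
    linarith [le_abs_self d, abs_nonneg d]
  linarith

open Finset in
lemma hs_two {ι : Type*} [Fintype ι] [DecidableEq ι] (T ρ φ γ : ι → ℝ) (μ s : ℝ)
    (hρ : ∑ j, ρ j ^ 2 = 1) (hφ : ∑ j, φ j ^ 2 = 1) (hγ : ∑ j, γ j ^ 2 = 1)
    (ho : ∑ j, φ j * γ j = 0)
    (hμ : μ = (∑ j, φ j * ρ j) ^ 2 - ∑ j, T j * φ j ^ 2)
    (hs : -s = (∑ j, γ j * ρ j) ^ 2 - ∑ j, T j * γ j ^ 2) :
    μ ^ 2 + s ^ 2 ≤ 1 - 2 * ∑ j, T j * ρ j ^ 2 + ∑ j, T j ^ 2 := by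
  have h0 : 0 ≤ ∑ i, ∑ j, (ρ i * ρ j - μ * (φ i * φ j) + s * (γ i * γ j) - if j = i then T i else 0) ^ 2 :=
    sum_nonneg fun i _ => sum_nonneg fun j _ => sq_nonneg _
  have e : ∀ i, ∑ j, (ρ i * ρ j - μ * (φ i * φ j) + s * (γ i * γ j) - if j = i then T i else 0) ^ 2
     = ρ i ^ 2 + μ ^ 2 * φ i ^ 2 + s ^ 2 * γ i ^ 2 - 2 * μ * (∑ j, φ j * ρ j) * (φ i * ρ i)
      + 2 * s * (∑ j, γ j * ρ j) * (γ i * ρ i)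
      - 2 * (T i * ρ i ^ 2) + 2 * μ * (T i * φ i ^ 2) - 2 * s * (T i * γ i ^ 2) + T i ^ 2 := by
    intro i
    have : ∀ j, (ρ i * ρ j - μ * (φ i * φ j) + s * (γ i * γ j) - if j = i then T i else 0) ^ 2
      = ρ i ^ 2 * ρ j ^ 2 + μ ^ 2 * φ i ^ 2 * φ j ^ 2 + s ^ 2 * γ i ^ 2 * γ j ^ 2
       - 2 * μ * (φ i * ρ i) * (φ j * ρ j) + 2 * s * (γ i * ρ i) * (γ j * ρ j)
       - 2 * μ * s * (φ i * γ i) * (φ j * γ j)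
       + if j = i then - 2 * (T i * ρ j ^ 2) + 2 * μ * (T i * φ j ^ 2) - 2 * s * (T i * γ j ^ 2) + T i ^ 2 else 0 := by
      intro j
      split_ifs with h
      · subst h; ring
      · ring
    simp only [this, sum_add_distrib, sum_sub_distrib, ← mul_sum, sum_ite_eq', mem_univ, if_true, hρ, hφ, hγ, ho]
    ring
  simp only [e, sum_add_distrib, sum_sub_distrib, ← mul_sum, hρ, hφ, hγ] at h0
  have h1 : μ * ∑ j, T j * φ j ^ 2 = μ * (∑ j, φ j * ρ j) ^ 2 - μ ^ 2 := by
    linear_combination μ * hμ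
  have h2 : s * ∑ j, T j * γ j ^ 2 = s * (∑ j, γ j * ρ j) ^ 2 + s ^ 2 := by
    linear_combination s * hs
  linarith

open Finset in
lemma sphere_max {ι : Type*} [Fintype ι] (Q : (ι → ℝ) → ℝ) (hQ : Continuous Q)
    (hh : ∀ (c : ℝ) u, Q (fun i => c * u i) = c ^ 2 * Q u) (u0 : ι → ℝ) (hu0 : ∑ j, u0 j ^ 2 = 1) :
    ∃ φ : ι → ℝ, ∑ j, φ j ^ 2 = 1 ∧ ∀ u, Q u ≤ Q φ * ∑ j, u j ^ 2 := by
  have hc : IsCompact {u : ι → ℝ | ∑ j, u j ^ 2 = 1} := by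
    apply IsCompact.of_isClosed_subset (isCompact_Icc (a := fun _ : ι => (-1:ℝ)) (b := fun _ => 1))
    · exact isClosed_eq (by fun_prop) continuous_const
    · intro u hu
      have hu : ∑ j, u j ^ 2 = 1 := hu
      have : ∀ i, u i ^ 2 ≤ 1 := fun i => by
        rw [← hu]; exact single_le_sum (f := fun i => u i ^ 2) (fun _ _ => sq_nonneg _) (mem_univ i)
      constructor <;> intro i <;> nlinarith [this i]
  obtain ⟨φ, hφ, hm⟩ := hc.exists_isMaxOn ⟨u0, hu0⟩ hQ.continuousOn
  refine ⟨φ, hφ, fun u => ?_⟩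
  by_cases h : ∑ j, u j ^ 2 = 0
  · have hz := (sum_eq_zero_iff_of_nonneg (fun j _ => sq_nonneg (u j))).1 h
    have : u = fun i => 0 * u i := by
      funext i; have := hz i (mem_univ i); simpa using this
    rw [h, this, hh]; simp
  · have hp : 0 < ∑ j, u j ^ 2 := lt_of_le_of_ne (sum_nonneg fun _ _ => sq_nonneg _) (Ne.symm h)
    set n := ∑ j, u j ^ 2
    have hs : √n ^ 2 = n := Real.sq_sqrt hp.le
    have hn : ∑ j, ((√n)⁻¹ * u j) ^ 2 = 1 := by
      simp only [mul_pow, ← mul_sum, inv_pow, hs]; exact inv_mul_cancel₀ h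
    have := hm (show (fun i => (√n)⁻¹ * u i) ∈ {u : ι → ℝ | ∑ j, u j ^ 2 = 1} from hn)
    simp only [Set.mem_ofPred_eq, hh, inv_pow, hs] at this
    rwa [inv_mul_le_iff₀ hp, mul_comm] at this

set_option maxHeartbeats 1000000 in
open Finset in
lemma fin_case {ι : Type*} [Fintype ι] [DecidableEq ι] (o : ι) (T ρ φ0 γ0 : ι → ℝ)
    (hρ : ∑ j, ρ j ^ 2 = 1) (hw : T o ≤ ρ o ^ 2) (hHS : ∑ j, T j ^ 2 ≤ ∑ j, T j * ρ j ^ 2)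
    (hmax : ∀ j, T j ≤ T o) (hφ0 : ∑ j, φ0 j ^ 2 = 1) (hγ0 : ∑ j, γ0 j ^ 2 = 1)
    (hS : 2 / √3 ≤ ((∑ j, φ0 j * ρ j) ^ 2 - ∑ j, T j * φ0 j ^ 2)
      - ((∑ j, γ0 j * ρ j) ^ 2 - ∑ j, T j * γ0 j ^ 2)) :
    T o = 1 / 3 ∧ ∑ j, T j * ρ j ^ 2 = 1 / 9 := by
  obtain ⟨φ, hφ, hφm⟩ := sphere_max (fun u => (∑ j, u j * ρ j) ^ 2 - ∑ j, T j * u j ^ 2) (by fun_prop)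
    (by intro c u; simp only [mul_pow, mul_assoc, ← mul_sum, mul_left_comm _ (c ^ 2)]; ring) φ0 hφ0
  obtain ⟨γ, hγ, hγm⟩ := sphere_max (fun u => -((∑ j, u j * ρ j) ^ 2 - ∑ j, T j * u j ^ 2)) (by fun_prop)
    (by intro c u; simp only [mul_pow, mul_assoc, ← mul_sum, mul_left_comm _ (c ^ 2)]; ring) φ0 hφ0
  obtain ⟨μ, hμ⟩ : ∃ μ, μ = (∑ j, φ j * ρ j) ^ 2 - ∑ j, T j * φ j ^ 2 := ⟨_, rfl⟩
  obtain ⟨s, hs⟩ : ∃ s, s = -((∑ j, γ j * ρ j) ^ 2 - ∑ j, T j * γ j ^ 2) := ⟨_, rfl⟩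
  simp only [← hμ] at hφm
  simp only [← hs] at hγm
  have hS1 : 2 / √3 ≤ μ + s := by
    have h1 := hφm φ0
    have h2 := hγm γ0
    rw [hφ0] at h1
    rw [hγ0] at h2
    linarith
  have h3 : (2 / √3) ^ 2 = 4 / 3 := by rw [div_pow, Real.sq_sqrt (by norm_num)]; norm_num
  have h3p : 0 < 2 / √3 := by positivity
  have hS2 : 4 / 3 ≤ (μ + s) ^ 2 := by rw [← h3]; exact pow_le_pow_left₀ h3p.le hS1 2
  have hsum : 0 < μ + s := by linarith
  obtain ⟨A, hA⟩ : ∃ A, A = ∑ j, φ j * ρ j := ⟨_, rfl⟩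
  obtain ⟨B, hB⟩ : ∃ B, B = ∑ j, γ j * ρ j := ⟨_, rfl⟩
  have eφ : ∀ j, (μ + T j) * φ j = A * ρ j := by
    intro j
    have := crit_lemma T ρ φ μ (-1) 1 (fun u => by linarith [hφm u]) (by rw [hφ]; linarith) j
    rw [← hA] at this; linarith
  have eγ : ∀ j, (T j - s) * γ j = B * ρ j := by
    intro j
    have := crit_lemma T ρ γ s 1 (-1) (fun u => by linarith [hγm u]) (by rw [hγ]; linarith) j
    rw [← hB] at this; linarith
  have hor : ∑ j, φ j * γ j = 0 := by
    have : (μ + s) * ∑ j, φ j * γ j = 0 := by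
      have : (μ + s) * ∑ j, φ j * γ j = ∑ j, (A * (γ j * ρ j) - B * (φ j * ρ j)) := by
        rw [mul_sum]; refine sum_congr rfl fun j _ => ?_
        linear_combination (γ j) * eφ j - φ j * eγ j
      rw [this, sum_sub_distrib, ← mul_sum, ← mul_sum, ← hA, ← hB]; ring
    rcases mul_eq_zero.1 this with h | h
    · linarith
    · exact h
  have hHS2 := hs_two T ρ φ γ μ s hρ hφ hγ hor hμ (by linarith)
  obtain ⟨v, hv⟩ : ∃ v, v = ∑ j, T j * ρ j ^ 2 := ⟨_, rfl⟩
  obtain ⟨N, hN⟩ : ∃ N, N = ∑ j, T j ^ 2 := ⟨_, rfl⟩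
  have hN0 : 0 ≤ N := by rw [hN]; exact sum_nonneg fun _ _ => sq_nonneg _
  rw [← hv, ← hN] at hHS2
  have hHS' : N ≤ v := by rw [hv, hN]; exact hHS
  have h1lt : 1 < μ + s := by nlinarith
  have hspos : 0 < s := by
    have : μ ≤ 1 := by nlinarith [sq_nonneg s]
    linarith
  have hμpos : 0 < μ := by
    have : s ≤ 1 := by nlinarith [sq_nonneg μ]
    linarith
  have hst : s ≤ T o := by
    have : ∑ j, T j * γ j ^ 2 ≤ ∑ j, T o * γ j ^ 2 :=
      sum_le_sum fun j _ => mul_le_mul_of_nonneg_right (hmax j) (sq_nonneg _)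
    rw [← mul_sum, hγ] at this
    nlinarith [sq_nonneg (∑ j, γ j * ρ j)]
  have hTμ : ∀ j, 0 ≤ μ + T j := by
    intro j
    have := hφm (fun i => if i = j then 1 else 0)
    simp at this
    nlinarith [sq_nonneg (ρ j)]
  have hTs : ∀ j, j ≠ o → T j ≤ s := by
    intro j hj
    have h := hγm (fun i => (if i = o then ρ j else 0) - (if i = j then ρ o else 0))
    have e1 : ∑ i, ((if i = o then ρ j else 0) - (if i = j then ρ o else 0)) * ρ i = 0 := by
      simp only [sub_mul, sum_sub_distrib, ite_mul, zero_mul, sum_ite_eq', mem_univ, if_true]; ring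
    have p : ∀ i, ((if i = o then ρ j else 0) - (if i = j then ρ o else 0)) ^ 2
       = (if i = o then ρ j ^ 2 else 0) + (if i = j then ρ o ^ 2 else 0) := by
      intro i
      by_cases h1 : i = o
      · have h2 : i ≠ j := fun h => hj (h.symm.trans h1)
        simp only [if_pos h1, if_neg h2]; ring
      · simp only [if_neg h1]
        split_ifs <;> ring
    simp only [e1, p, mul_add, sum_add_distrib, mul_ite, mul_zero, sum_ite_eq', mem_univ, if_true] at h
    have hp : 0 < ρ j ^ 2 + ρ o ^ 2 := by nlinarith [sq_nonneg (ρ j)]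
    have : T j * (ρ j ^ 2 + ρ o ^ 2) ≤ s * (ρ j ^ 2 + ρ o ^ 2) := by
      nlinarith [mul_le_mul_of_nonneg_right (hmax j) (sq_nonneg (ρ j))]
    exact le_of_mul_le_mul_right this hp
  have hpair : ∀ j, j ≠ o → T o ^ 2 + T j ^ 2 ≤ N := by
    intro j hj
    rw [hN, ← sum_pair hj.symm (f := fun i => T i ^ 2)]
    exact sum_le_sum_of_subset_of_nonneg (subset_univ _) fun _ _ _ => sq_nonneg _
  have hsst : s ^ 2 ≤ T o ^ 2 := pow_le_pow_left₀ hspos.le hst 2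
  by_cases hA0 : A = 0
  · exfalso
    obtain ⟨j, hj⟩ : ∃ j, φ j ≠ 0 := by
      by_contra hc
      push Not at hc
      simp [hc] at hφ
    have h := eφ j
    rw [hA0, zero_mul] at h
    have hTj : μ + T j = 0 := by simpa [hj] using h
    have hjo : j ≠ o := by rintro rfl; linarith
    have := hpair j hjo
    have e : T j ^ 2 = μ ^ 2 := by rw [show T j = -μ by linarith]; ring
    nlinarith [sq_nonneg (μ - s)]
  by_cases hB0 : B = 0
  · exfalso
    obtain ⟨j, hjo, hj⟩ : ∃ j, j ≠ o ∧ γ j ≠ 0 := by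
      by_contra hc
      push Not at hc
      have hb : B = γ o * ρ o := by
        rw [hB]; exact sum_eq_single o (fun j _ hj => by rw [hc j hj, zero_mul]) (by simp)
      have hg : ∑ j, γ j ^ 2 = γ o ^ 2 := sum_eq_single o (fun j _ hj => by rw [hc j hj]; ring) (by simp)
      rw [hg] at hγ
      rw [hB0] at hb
      rcases mul_eq_zero.1 hb.symm with h | h
      · rw [h] at hγ; norm_num at hγ
      · rw [h] at hw; linarith
    have h := eγ j
    rw [hB0, zero_mul] at h
    have hTj : T j = s := by
      have : T j - s = 0 := by simpa [hj] using h
      linarith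
    have hp := hpair j hjo
    rw [hTj] at hp
    have hm : μ = 3 * s := by
      have e : (μ - 3 * s) ^ 2 = 4 * (μ ^ 2 + 3 * s ^ 2) - 3 * (μ + s) ^ 2 := by ring
      have : (μ - 3 * s) ^ 2 ≤ 0 := by linarith
      have : μ - 3 * s = 0 := by simpa using le_antisymm this (sq_nonneg _)
      linarith
    have hm2 : μ ^ 2 = 9 * s ^ 2 := by rw [hm]; ring
    have hm3 : (μ + s) ^ 2 = 16 * s ^ 2 := by rw [hm]; ring
    have hs12 : 12 * s ^ 2 = 1 := by linarith
    have hv2 : v = 2 * s ^ 2 := by linarith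
    have hN2 : N = 2 * s ^ 2 := by linarith
    have hto : T o = s := by
      have : T o ^ 2 = s ^ 2 := by linarith
      exact (pow_left_inj₀ (by linarith) hspos.le two_ne_zero).1 this
    have hall : ∀ i, T i ^ 2 = s * T i := by
      intro i
      by_cases hio : i = o
      · rw [hio, hto]; ring
      by_cases hij : i = j
      · rw [hij, hTj]; ring
      have : T i ^ 2 + (T o ^ 2 + T j ^ 2) ≤ N := by
        rw [hN, ← sum_pair hjo.symm (f := fun i => T i ^ 2),
          ← sum_insert (a := i) (f := fun i => T i ^ 2) (by simp [hio, hij])]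
        exact sum_le_sum_of_subset_of_nonneg (subset_univ _) fun _ _ _ => sq_nonneg _
      rw [hto, hTj] at this
      have : T i ^ 2 ≤ 0 := by linarith
      have : T i = 0 := by simpa using le_antisymm this (sq_nonneg _)
      rw [this]; ring
    have s1 : ∑ i, T i * (φ i * ρ i) = A * (1 - μ) := by
      have : ∑ i, T i * (φ i * ρ i) = ∑ i, (A * ρ i ^ 2 - μ * (φ i * ρ i)) :=
        sum_congr rfl fun i _ => by linear_combination ρ i * eφ i
      rw [this, sum_sub_distrib, ← mul_sum, ← mul_sum, hρ, ← hA]; ring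
    have s2 : s * ∑ i, T i * (φ i * ρ i) = A * v - μ * (A * (1 - μ)) := by
      have : s * ∑ i, T i * (φ i * ρ i) = ∑ i, (A * (T i * ρ i ^ 2) - μ * (T i * (φ i * ρ i))) := by
        rw [mul_sum]
        exact sum_congr rfl fun i _ => by linear_combination ρ i * T i * eφ i - φ i * ρ i * hall i
      rw [this, sum_sub_distrib, ← mul_sum, ← mul_sum, s1, ← hv]
    rw [s1] at s2
    have h4 : s * (1 - μ) = v - μ * (1 - μ) := mul_left_cancel₀ hA0 (by linarith)
    rw [hm, hv2] at h4
    have : s * (14 * s - 4) = 0 := by linarith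
    rcases mul_eq_zero.1 this with h | h
    · linarith
    · have : s = 2 / 7 := by linarith
      rw [this] at hs12; norm_num at hs12
  rcases lt_or_gt_of_ne (mul_ne_zero hA0 hB0) with h | h
  · refine eig_case o T φ (fun j => - γ j) ρ μ s A (-B) eφ (fun j => by linarith [eγ j]) hA ?_ hρ
      (by linarith) hw hHS hTs hTμ hspos hst hμpos hS2
    rw [hB, ← sum_neg_distrib]
    exact sum_congr rfl fun j _ => by ring
  · exact eig_case o T φ γ ρ μ s A B eφ eγ hA hB hρ h hw hHS hTs hTμ hspos hst hμpos hS2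

open Finset Submodule in
lemma abs_fam {H : Type*} [NormedAddCommGroup H] [InnerProductSpace ℝ H]
    (V : H →ₗ[ℝ] H) (hV : V.IsSymmetric) (r e f g : H) (t : ℝ)
    (he : inner ℝ e e = (1:ℝ)) (hVe : V e = t • e) :
    ∃ (n : ℕ) (b : Option (Fin n) → H) (T : Option (Fin n) → ℝ), Orthonormal ℝ b ∧
      b none = e ∧ T none = t ∧
      (∀ i j, (inner ℝ (b i) (V (b j)) : ℝ) = if i = j then T i else 0) ∧
      (∀ x, (x = r ∨ x = f ∨ x = g) → x = ∑ i, (inner ℝ (b i) x : ℝ) • b i) := by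
  classical
  set pr : H → H := fun x => x - (inner ℝ e x : ℝ) • e with hpr
  set E : Submodule ℝ H := span ℝ {pr r, pr f, pr g} with hE
  have : FiniteDimensional ℝ E := by
    rw [hE]; exact FiniteDimensional.span_of_finite ℝ (by simp)
  have hEe : ∀ x ∈ E, inner ℝ e x = (0:ℝ) := by
    intro x hx
    have : E ≤ (LinearMap.ker (innerₛₗ ℝ e)) := by
      rw [hE, span_le]
      rintro y (rfl | rfl | rfl) <;>
        simp only [hpr, SetLike.mem_coe, LinearMap.mem_ker, innerₛₗ_apply_apply, inner_sub_right, inner_smul_right, he] <;> ring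
    simpa using this hx
  set C : E →ₗ[ℝ] E := (E.orthogonalProjectionOnto : H →ₗ[ℝ] E) ∘ₗ V ∘ₗ E.subtype with hC
  have hCi : ∀ x y : E, (inner ℝ x (C y) : ℝ) = inner ℝ (x : H) (V y) := by
    intro x y
    simp [hC]
  have hCs : C.IsSymmetric := by
    intro x y
    rw [real_inner_comm, hCi, hCi, real_inner_comm, hV]
  obtain ⟨n, hn⟩ : ∃ n, Module.finrank ℝ E = n := ⟨_, rfl⟩
  obtain ⟨c, hc⟩ : ∃ c, c = hCs.eigenvectorBasis hn := ⟨_, rfl⟩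
  obtain ⟨τ, hτ⟩ : ∃ τ : Fin n → ℝ, ∀ j, C (c j) = τ j • c j :=
    ⟨hCs.eigenvalues hn, fun j => by rw [hc, hCs.apply_eigenvectorBasis hn j]; rfl⟩
  have hcc := orthonormal_iff_ite.1 c.orthonormal
  have hcc' : ∀ i j, inner ℝ (c i : H) (c j : H) = if i = j then (1:ℝ) else 0 := fun i j => hcc i j
  have he1 : ∀ j, inner ℝ e (c j : H) = (0:ℝ) := fun j => hEe _ (c j).2
  have he2 : ∀ j, inner ℝ (c j : H) e = (0:ℝ) := fun j => by rw [real_inner_comm]; exact he1 j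
  refine ⟨n, fun i => i.elim e (fun j => (c j : H)), fun i => i.elim t τ, ?_, rfl, rfl, ?_, ?_⟩
  · rw [orthonormal_iff_ite]
    rintro (_ | i) (_ | j)
    · rw [if_pos rfl]; exact he
    · rw [if_neg (by simp)]; exact he1 j
    · rw [if_neg (by simp)]; exact he2 i
    · simp only [Option.elim, Option.some.injEq]; exact hcc' i j
  · rintro (_ | i) (_ | j)
    · simp only [Option.elim, hVe, inner_smul_right, he, if_true, mul_one]
    · rw [if_neg (by simp)]
      simp only [Option.elim]
      rw [← hV e, hVe, inner_smul_left, he1]; simp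
    · rw [if_neg (by simp)]
      simp only [Option.elim, hVe, inner_smul_right, he2, mul_zero]
    · have h1 := hCi (c i) (c j)
      rw [hτ, inner_smul_right, hcc] at h1
      simp only [Option.elim, ← h1, Option.some.injEq]
      split_ifs with h
      · rw [h]; simp
      · simp
  · intro x hx
    have hx : pr x ∈ E := by
      rcases hx with rfl | rfl | rfl <;> exact subset_span (by simp)
    have h1 := c.sum_repr' ⟨pr x, hx⟩
    have h2 : pr x = ∑ j, (inner ℝ (c j : H) (pr x) : ℝ) • (c j : H) := by
      have := congrArg (Subtype.val) h1
      simpa using this.symm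
    rw [Fintype.sum_option]
    have h3 : ∀ j, (inner ℝ (c j : H) (pr x) : ℝ) = inner ℝ (c j : H) x := by
      intro j
      simp only [hpr, inner_sub_right, inner_smul_right, he2]; ring
    simp only [h3] at h2
    simp only [Option.elim]
    rw [← h2, hpr]; simp

open Finset in
lemma abs_fin {H : Type*} [NormedAddCommGroup H] [InnerProductSpace ℝ H] {ι : Type} [Fintype ι] [DecidableEq ι]
    (V : H →ₗ[ℝ] H) (b : ι → H) (T : ι → ℝ)
    (hbV : ∀ i j, (inner ℝ (b i) (V (b j)) : ℝ) = if i = j then T i else 0) (x : H)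
    (hx : x = ∑ i, (inner ℝ (b i) x : ℝ) • b i) :
    (∀ y, (inner ℝ x y : ℝ) = ∑ i, (inner ℝ (b i) x : ℝ) * inner ℝ (b i) y) ∧
    (inner ℝ x (V x) : ℝ) = ∑ i, T i * (inner ℝ (b i) x : ℝ) ^ 2 := by
  have hin : ∀ y, (inner ℝ x y : ℝ) = ∑ i, (inner ℝ (b i) x : ℝ) * inner ℝ (b i) y := by
    intro y
    conv_lhs => rw [hx]
    simp [sum_inner, inner_smul_left]
  refine ⟨hin, ?_⟩
  rw [hin]
  refine sum_congr rfl fun i _ => ?_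
  have : (inner ℝ (b i) (V x) : ℝ) = T i * inner ℝ (b i) x := by
    conv_lhs => rw [hx]
    simp only [map_sum, map_smul, inner_sum, inner_smul_right, hbV, mul_ite, mul_zero, sum_ite_eq,
      mem_univ, if_true]
    ring
  rw [this]; ring

open Finset Submodule in
lemma abs_case {H : Type*} [NormedAddCommGroup H] [InnerProductSpace ℝ H]
    (V : H →ₗ[ℝ] H) (hV : V.IsSymmetric) (r e f g : H) (t : ℝ)
    (hr : inner ℝ r r = (1:ℝ)) (he : inner ℝ e e = (1:ℝ)) (hf : inner ℝ f f = (1:ℝ))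
    (hg : inner ℝ g g = (1:ℝ))
    (hVe : V e = t • e) (hmax : ∀ h : H, inner ℝ h (V h) ≤ t * inner ℝ h h)
    (hte : t ≤ (inner ℝ e r : ℝ) ^ 2)
    (hHS : ∀ (ι : Type) [Fintype ι] (b : ι → H), Orthonormal ℝ b →
      ∑ i, ∑ j, (inner ℝ (b i) (V (b j)) : ℝ) ^ 2 ≤ inner ℝ r (V r))
    (hS : 2 / √3 ≤ ((inner ℝ f r : ℝ) ^ 2 - inner ℝ f (V f)) - ((inner ℝ g r : ℝ) ^ 2 - inner ℝ g (V g))) :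
    t = 1 / 3 ∧ (inner ℝ r (V r) : ℝ) = 1 / 9 := by
  obtain ⟨n, b, T, hb, hbe, hTt, hbV, hexp⟩ := abs_fam V hV r e f g t he hVe
  obtain ⟨ir, vr⟩ := abs_fin V b T hbV r (hexp r (by simp))
  obtain ⟨jf, vf⟩ := abs_fin V b T hbV f (hexp f (by simp))
  obtain ⟨ig, vg⟩ := abs_fin V b T hbV g (hexp g (by simp))
  have hHS' := hHS _ b hb
  have hTT : ∑ i, ∑ j, (inner ℝ (b i) (V (b j)) : ℝ) ^ 2 = ∑ i, T i ^ 2 := by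
    refine sum_congr rfl fun i _ => ?_
    simp only [hbV, ite_pow, ne_eq, OfNat.ofNat_ne_zero, not_false_eq_true, zero_pow, sum_ite_eq, mem_univ, if_true]
  rw [hTT, vr] at hHS'
  have hbb := orthonormal_iff_ite.1 hb
  have := fin_case (none : Option (Fin n)) T (fun i => inner ℝ (b i) r) (fun i => inner ℝ (b i) f)
    (fun i => inner ℝ (b i) g) (by rw [← hr, ir]; exact sum_congr rfl fun i _ => by ring)
    (by rw [hTt, hbe]; exact hte) hHS'
    (by
      intro j
      have h1 := hmax (b j)
      rw [hbV, hbb, if_pos rfl, if_pos rfl] at h1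
      rw [hTt]; linarith)
    (by rw [← hf, jf]; exact sum_congr rfl fun i _ => by ring)
    (by rw [← hg, ig]; exact sum_congr rfl fun i _ => by ring)
    (by rw [← vf, ← vg, ← jf r, ← ig r]; exact hS)
  rw [vr, ← hTt]
  exact this

open Finset Submodule in
lemma hs_compact {H : Type*} [NormedAddCommGroup H] [InnerProductSpace ℝ H] [CompleteSpace H]
    (V : H →L[ℝ] H) (c : ℝ)
    (hHS : ∀ (ι : Type) [Fintype ι] (b : ι → H), Orthonormal ℝ b → ∑ i, ‖V (b i)‖ ^ 2 ≤ c) :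
    IsCompactOperator V := by
  let S : Set ℝ := {s | ∃ (n : ℕ) (b : Fin n → H), Orthonormal ℝ b ∧ s = ∑ i, ‖V (b i)‖ ^ 2}
  have hSn : S.Nonempty := ⟨0, 0, fun i => i.elim0, ⟨fun i => i.elim0, fun i => i.elim0⟩, by simp⟩
  have hSb : BddAbove S := ⟨c, by rintro s ⟨n, b, hb, rfl⟩; exact hHS _ b hb⟩
  have hfull : ∀ (ι : Type) [Fintype ι] (b : ι → H), Orthonormal ℝ b → ∑ i, ‖V (b i)‖ ^ 2 ≤ sSup S := by
    intro ι _ b hb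
    let e := (Fintype.equivFin ι).symm
    refine le_csSup hSb ⟨_, b ∘ e, hb.comp e e.injective, ?_⟩
    exact (e.sum_comp (fun i => ‖V (b i)‖ ^ 2)).symm
  have happ : ∀ ε : ℝ, 0 < ε → ∃ A : H →L[ℝ] H, IsCompactOperator A ∧ ‖V - A‖ ≤ ε := by
    intro ε hε
    obtain ⟨s, ⟨n, b, hb, rfl⟩, hs⟩ := exists_lt_of_lt_csSup hSn (show sSup S - ε ^ 2 < sSup S by
      have : 0 < ε ^ 2 := by positivity
      linarith)
    set E := span ℝ (Set.range b) with hE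
    have : FiniteDimensional ℝ E := FiniteDimensional.span_of_finite ℝ (Set.finite_range b)
    have hun : ∀ h : H, ‖h‖ = 1 → h ∈ Eᗮ → ‖V h‖ ≤ ε := by
      intro h h1 h2
      have hort : ∀ i, inner ℝ (b i) h = (0:ℝ) := fun i => h2 (b i) (subset_span ⟨i, rfl⟩)
      have hbb := orthonormal_iff_ite.1 hb
      have := hfull (Option (Fin n)) (fun i => i.elim h b) (by
        rw [orthonormal_iff_ite]
        rintro (_ | i) (_ | j)
        · simp [h1]
        · rw [if_neg (by simp), real_inner_comm]; exact hort j
        · rw [if_neg (by simp)]; exact hort i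
        · simp only [Option.elim, Option.some.injEq]; exact hbb i j)
      rw [Fintype.sum_option] at this
      simp only [Option.elim] at this
      have h3 : ‖V h‖ ^ 2 ≤ ε ^ 2 := by linarith
      exact le_of_sq_le_sq h3 hε.le
    refine ⟨V ∘L E.subtypeL ∘L E.orthogonalProjectionOnto, ?_, ?_⟩
    · have : IsCompactOperator (E.orthogonalProjectionOnto) :=
        isCompactOperator_of_locallyCompactSpace_dom _
      exact this.clm_comp (V ∘L E.subtypeL)
    · refine ContinuousLinearMap.opNorm_le_bound _ hε.le fun x => ?_
      set h := x - (E.orthogonalProjectionOnto x : H) with hh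
      have hmem : h ∈ Eᗮ := E.sub_starProjection_mem_orthogonal x
      have e1 : (V - V ∘L E.subtypeL ∘L E.orthogonalProjectionOnto) x = V h := by
        simp [hh]
      rw [e1]
      have hle : ‖h‖ ≤ ‖x‖ := by
        have h1 : inner ℝ (E.orthogonalProjectionOnto x : H) h = (0:ℝ) :=
          hmem _ (E.orthogonalProjectionOnto x).2
        have h2 : x = (E.orthogonalProjectionOnto x : H) + h := by rw [hh]; abel
        have h3 := norm_add_sq_real (E.orthogonalProjectionOnto x : H) h
        rw [← h2, h1] at h3
        exact le_of_sq_le_sq (by nlinarith [sq_nonneg ‖(E.orthogonalProjectionOnto x : H)‖]) (norm_nonneg _)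
      by_cases h0 : h = 0
      · rw [h0]; simp; positivity
      · have hn : ‖h‖ ≠ 0 := norm_ne_zero_iff.2 h0
        have := hun ((‖h‖)⁻¹ • h) (by simp [norm_smul, hn]) (Eᗮ.smul_mem _ hmem)
        rw [map_smul, norm_smul, norm_inv, norm_norm, inv_mul_le_iff₀ (by positivity)] at this
        nlinarith
  have hcl := isClosed_setOfPred_isCompactOperator (σ₁₂ := RingHom.id ℝ) (M₁ := H) (M₂ := H)
  have : V ∈ closure {f : H →L[ℝ] H | IsCompactOperator f} := by
    rw [Metric.mem_closure_iff]
    intro ε hε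
    obtain ⟨A, hA, hVA⟩ := happ (ε / 2) (by linarith)
    exact ⟨A, hA, by rw [dist_eq_norm]; linarith⟩
  rw [hcl.closure_eq] at this
  exact this

lemma compact_eig {H : Type*} [NormedAddCommGroup H] [InnerProductSpace ℝ H] [CompleteSpace H]
    (V : H →L[ℝ] H) (hc : IsCompactOperator V) (hV : (V : H →ₗ[ℝ] H).IsSymmetric) (h0 : V ≠ 0) :
    ∃ (e : H) (l : ℝ), ‖e‖ = 1 ∧ V e = l • e ∧ |l| = ‖V‖ := by
  have hr := V.spectralRadius_eq_nnnorm hV.isSelfAdjoint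
  have hne : (spectrum ℝ V).Nonempty := by
    by_contra hc
    rw [Set.not_nonempty_iff_eq_empty] at hc
    rw [spectralRadius, hc] at hr
    simp at hr
    exact h0 (by simpa using hr.symm)
  obtain ⟨k, hk, hk2⟩ := spectrum.exists_nnnorm_eq_spectralRadius_of_nonempty hne
  rw [hr] at hk2
  have hk3 : |k| = ‖V‖ := by
    have : ‖k‖₊ = ‖V‖₊ := by exact_mod_cast hk2
    have := congrArg NNReal.toReal this
    simpa using this
  have hk0 : k ≠ 0 := by
    rintro rfl
    simp at hk3
    exact h0 (by simpa using hk3.symm)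
  obtain ⟨x, hx⟩ := ((hc.hasEigenvalue_iff_mem_spectrum hk0).2 hk).exists_hasEigenvector
  have hxn : ‖x‖ ≠ 0 := norm_ne_zero_iff.2 hx.2
  have hx1 : V x = k • x := by simpa using hx.apply_eq_smul
  exact ⟨(‖x‖)⁻¹ • x, k, by simp [norm_smul, hxn], by rw [map_smul, hx1, smul_comm], hk3⟩

/-- a unit maximizer of the quadratic form is an eigenvector -/
lemma max_eig {H : Type*} [NormedAddCommGroup H] [InnerProductSpace ℝ H]
    (V : H →ₗ[ℝ] H) (hV : V.IsSymmetric) (e : H) (t : ℝ) (he : inner ℝ e e = (1 : ℝ))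
    (hmax : ∀ h : H, inner ℝ h (V h) ≤ t * inner ℝ h h) (het : inner ℝ e (V e) = t) : V e = t • e := by
  set u := t • e - V e with hu
  have h : ∀ ε : ℝ, 0 ≤ 2 * ε * inner ℝ u u + ε ^ 2 * (t * inner ℝ u u - inner ℝ u (V u)) := by
    intro ε
    have h1 := hmax (e + ε • u)
    have e1 : inner ℝ e (V u) = inner ℝ u (V e) := by rw [← hV, real_inner_comm]
    have e2 : inner ℝ u u = t * inner ℝ e u - inner ℝ u (V e) := by
      conv_lhs => rw [hu, inner_sub_left, inner_smul_left]
      rw [real_inner_comm u (V e)]; simp [hu]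
    simp only [map_add, map_smul, inner_add_left, inner_add_right, inner_smul_left, inner_smul_right,
      e1, het, he, real_inner_comm e u] at h1
    rw [e2]
    rw [e2] at h1
    simp only [RCLike.conj_to_real] at h1
    nlinarith
  have hu0 : (inner ℝ u u : ℝ) = 0 := by
    generalize (t * inner ℝ u u - inner ℝ u (V u) : ℝ) = d at h
    have hp0 : 0 ≤ (inner ℝ u u : ℝ) := real_inner_self_nonneg
    generalize (inner ℝ u u : ℝ) = p at h hp0
    by_contra hp
    have hpp : 0 < p := lt_of_le_of_ne hp0 (Ne.symm hp)
    have h := h (-p / (|d| + p + 1))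
    have e : 2 * (-p / (|d| + p + 1)) * p + (-p / (|d| + p + 1)) ^ 2 * d
        = p ^ 2 * (d - 2 * (|d| + p + 1)) / (|d| + p + 1) ^ 2 := by field_simp; ring
    rw [e] at h
    have h2 : p ^ 2 * (d - 2 * (|d| + p + 1)) / (|d| + p + 1) ^ 2 < 0 := by
      apply div_neg_of_neg_of_pos _ (by positivity)
      apply mul_neg_of_pos_of_neg (by positivity)
      linarith [le_abs_self d, abs_nonneg d]
    linarith
  have := inner_self_eq_zero.1 hu0
  rw [hu, sub_eq_zero] at this
  exact this.symm

open MeasureTheory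

section kern
variable {α : Type*} [MeasurableSpace α] {m : Measure α} [IsProbabilityMeasure m]

lemma ten_memLp (h k : Lp ℝ 2 m) : MemLp (fun p : α × α => h p.1 * k p.2) 2 (m.prod m) := by
  have hh : AEStronglyMeasurable (fun p : α × α => h p.1) (m.prod m) :=
    (Lp.aestronglyMeasurable h).comp_fst
  have hk : AEStronglyMeasurable (fun p : α × α => k p.2) (m.prod m) :=
    (Lp.aestronglyMeasurable k).comp_snd
  refine (memLp_two_iff_integrable_sq (hh.mul hk)).2 ?_
  have := (Lp.memLp h).integrable_sq.mul_prod (Lp.memLp k).integrable_sq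
  refine this.congr (Filter.Eventually.of_forall fun p => ?_)
  simp only [Pi.mul_apply]
  ring

noncomputable def ten (h k : Lp ℝ 2 m) : Lp ℝ 2 (m.prod m) := (ten_memLp h k).toLp _

lemma ten_coe (h k : Lp ℝ 2 m) : ten h k =ᵐ[m.prod m] fun p => h p.1 * k p.2 :=
  (ten_memLp h k).coeFn_toLp

lemma ten_inner (h k h' k' : Lp ℝ 2 m) :
    (inner ℝ (ten h k) (ten h' k') : ℝ) = inner ℝ h h' * inner ℝ k k' := by
  rw [L2.inner_def, L2.inner_def, L2.inner_def, ← integral_prod_mul]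
  refine integral_congr_ae ?_
  filter_upwards [ten_coe h k, ten_coe h' k'] with p h1 h2
  rw [h1, h2]
  simp; ring

lemma ten_norm (h k : Lp ℝ 2 m) : ‖ten h k‖ = ‖h‖ * ‖k‖ := by
  have := ten_inner h k h k
  simp only [real_inner_self_eq_norm_sq] at this
  rw [← mul_pow] at this
  exact (pow_left_inj₀ (norm_nonneg _) (by positivity) two_ne_zero).1 this

lemma ae_fst {p : α → Prop} (h : ∀ᵐ x ∂m, p x) : ∀ᵐ z ∂(m.prod m), p z.1 :=
  Measure.quasiMeasurePreserving_fst.ae h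
lemma ae_snd {p : α → Prop} (h : ∀ᵐ x ∂m, p x) : ∀ᵐ z ∂(m.prod m), p z.2 :=
  Measure.quasiMeasurePreserving_snd.ae h

lemma ker_op (K : Lp ℝ 2 (m.prod m)) :
    ∃ V : Lp ℝ 2 m →L[ℝ] Lp ℝ 2 m, ∀ h k, (inner ℝ (V h) k : ℝ) = inner ℝ K (ten h k) := by
  let B : Lp ℝ 2 m →ₗ[ℝ] Lp ℝ 2 m →ₗ[ℝ] ℝ := LinearMap.mk₂ ℝ (fun h k => inner ℝ K (ten h k))
    (by
      intro h h' k
      rw [← inner_add_right]; congr 1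
      refine Lp.ext ?_
      filter_upwards [ten_coe (h + h') k, ten_coe h k, ten_coe h' k, Lp.coeFn_add (ten h k) (ten h' k),
        ae_fst (Lp.coeFn_add h h')] with p h1 h2 h3 h4 h5
      simp only [Pi.add_apply] at h4 h5
      rw [h1, h4, h2, h3, h5]; ring)
    (by
      intro c h k
      rw [smul_eq_mul, ← real_inner_smul_right]; congr 1
      refine Lp.ext ?_
      filter_upwards [ten_coe (c • h) k, ten_coe h k, Lp.coeFn_smul c (ten h k),
        ae_fst (Lp.coeFn_smul c h)] with p h1 h2 h4 h5
      simp only [Pi.smul_apply, smul_eq_mul] at h4 h5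
      rw [h1, h4, h2, h5]; ring)
    (by
      intro k h h'
      rw [← inner_add_right]; congr 1
      refine Lp.ext ?_
      filter_upwards [ten_coe k (h + h'), ten_coe k h, ten_coe k h', Lp.coeFn_add (ten k h) (ten k h'),
        ae_snd (Lp.coeFn_add h h')] with p h1 h2 h3 h4 h5
      simp only [Pi.add_apply] at h4 h5
      rw [h1, h4, h2, h3, h5]; ring)
    (by
      intro c k h
      rw [smul_eq_mul, ← real_inner_smul_right]; congr 1
      refine Lp.ext ?_
      filter_upwards [ten_coe k (c • h), ten_coe k h, Lp.coeFn_smul c (ten k h),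
        ae_snd (Lp.coeFn_smul c h)] with p h1 h2 h4 h5
      simp only [Pi.smul_apply, smul_eq_mul] at h4 h5
      rw [h1, h4, h2, h5]; ring)
  let C : Lp ℝ 2 m →L[ℝ] Lp ℝ 2 m →L[ℝ] ℝ := B.mkContinuous₂ ‖K‖ (by
    intro h k
    have := norm_inner_le_norm (𝕜 := ℝ) K (ten h k)
    rw [ten_norm, ← mul_assoc] at this
    exact this)
  exact ⟨InnerProductSpace.continuousLinearMapOfBilin (𝕜 := ℝ) C, fun h k =>
    InnerProductSpace.continuousLinearMapOfBilin_apply C h k⟩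

lemma ten_orthonormal {ι ι' : Type*} (b : ι → Lp ℝ 2 m) (c : ι' → Lp ℝ 2 m) (hb : Orthonormal ℝ b)
    (hc : Orthonormal ℝ c) : Orthonormal ℝ (fun p : ι × ι' => ten (b p.1) (c p.2)) := by
  classical
  rw [orthonormal_iff_ite] at *
  rintro ⟨i, j⟩ ⟨i', j'⟩
  rw [ten_inner, hb, hc]
  simp only [Prod.mk.injEq]
  split_ifs <;> simp_all

open Finset in
lemma ker_hs (K : Lp ℝ 2 (m.prod m)) (V : Lp ℝ 2 m →L[ℝ] Lp ℝ 2 m)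
    (hV : ∀ h k, (inner ℝ (V h) k : ℝ) = inner ℝ K (ten h k)) {ι ι' : Type*} [Fintype ι] [Fintype ι']
    (b : ι → Lp ℝ 2 m) (c : ι' → Lp ℝ 2 m) (hb : Orthonormal ℝ b)
    (hc : Orthonormal ℝ c) : ∑ i, ∑ j, (inner ℝ (V (b i)) (c j) : ℝ) ^ 2 ≤ ‖K‖ ^ 2 := by
  have := (ten_orthonormal b c hb hc).sum_inner_products_le K (s := univ)
  rw [← univ_product_univ, sum_product] at this
  refine le_trans (le_of_eq ?_) this
  refine sum_congr rfl fun i _ => sum_congr rfl fun j _ => ?_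
  rw [hV, real_inner_comm, Real.norm_eq_abs, sq_abs]

open Finset in
lemma ker_compact (K : Lp ℝ 2 (m.prod m)) (V : Lp ℝ 2 m →L[ℝ] Lp ℝ 2 m)
    (hV : ∀ h k, (inner ℝ (V h) k : ℝ) = inner ℝ K (ten h k)) : IsCompactOperator V := by
  refine hs_compact V (‖K‖ ^ 2) fun ι _ b hb => ?_
  let E := Submodule.span ℝ (Set.range fun i => V (b i))
  have : FiniteDimensional ℝ E := FiniteDimensional.span_of_finite ℝ (Set.finite_range _)
  let c := stdOrthonormalBasis ℝ E
  have hc : Orthonormal ℝ (fun j => (c j : Lp ℝ 2 m)) :=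
    c.orthonormal.comp_linearIsometry E.subtypeₗᵢ
  refine le_trans (le_of_eq ?_) (ker_hs K V hV b _ hb hc)
  refine sum_congr rfl fun i _ => ?_
  have hm : V (b i) ∈ E := Submodule.subset_span ⟨i, rfl⟩
  have h1 := c.sum_sq_norm_inner_right ⟨V (b i), hm⟩
  have h2 : ‖V (b i)‖ ^ 2 = ‖(⟨V (b i), hm⟩ : E)‖ ^ 2 := rfl
  rw [h2, ← h1]
  refine sum_congr rfl fun j _ => ?_
  rw [real_inner_comm, Real.norm_eq_abs, sq_abs]
  rfl

end kern

open MeasureTheory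

section kern
variable {α : Type*} [MeasurableSpace α] {m : Measure α} [IsProbabilityMeasure m]

lemma kern_main (κ : α × α → ℝ) (hκm : Measurable κ) (h0 : ∀ p, 0 ≤ κ p) (h1 : ∀ p, κ p ≤ 1)
    (hsym : ∀ᵐ p ∂(m.prod m), κ p = κ p.swap) (f g : Lp ℝ 2 m) (hf : inner ℝ f f = (1:ℝ))
    (hg : inner ℝ g g = (1:ℝ))
    (hS : 2 / √3 ≤ ((∫ x, f x ∂m) ^ 2 - ∫ p, κ p * (f p.1 * f p.2) ∂(m.prod m))
      - ((∫ x, g x ∂m) ^ 2 - ∫ p, κ p * (g p.1 * g p.2) ∂(m.prod m))) :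
    ∃ e : Lp ℝ 2 m, (∀ᵐ p ∂(m.prod m), κ p = 1 / 3 * (e p.1 * e p.2)) ∧ (∀ᵐ x ∂m, 0 ≤ e x) ∧
      inner ℝ e e = (1:ℝ) ∧
      ∫ p, κ p ∂(m.prod m) = 1 / 9 ∧ ∫ p, κ p ^ 2 ∂(m.prod m) = 1 / 9 := by
  have hκL : MemLp κ 2 (m.prod m) := MemLp.of_bound hκm.aestronglyMeasurable 1
    (Filter.Eventually.of_forall fun p => by rw [Real.norm_eq_abs, abs_of_nonneg (h0 p)]; exact h1 p)
  obtain ⟨K, hK⟩ : ∃ K, K = hκL.toLp κ := ⟨_, rfl⟩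
  have hKc : K =ᵐ[m.prod m] κ := by rw [hK]; exact hκL.coeFn_toLp
  obtain ⟨V, hV⟩ := ker_op K
  have hKi : ∀ h k, (inner ℝ K (ten h k) : ℝ) = ∫ p, κ p * (h p.1 * k p.2) ∂(m.prod m) := by
    intro h k
    rw [L2.inner_def]
    refine integral_congr_ae ?_
    filter_upwards [hKc, ten_coe h k] with p a1 a2
    rw [a1, a2]; simp [mul_comm]
  have hfInt : ∀ h k : Lp ℝ 2 m, Integrable (fun p : α × α => h p.1 * k p.2) (m.prod m) :=
    fun h k => (ten_memLp h k).integrable (by norm_num)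
  have hfIntκ : ∀ h k : Lp ℝ 2 m, Integrable (fun p : α × α => κ p * (h p.1 * k p.2)) (m.prod m) := by
    intro h k
    refine (hfInt h k).bdd_mul (c := 1) hκm.aestronglyMeasurable
      (Filter.Eventually.of_forall fun p => by rw [Real.norm_eq_abs, abs_of_nonneg (h0 p)]; exact h1 p)
  have hKK : ‖K‖ ^ 2 = ∫ p, κ p ^ 2 ∂(m.prod m) := by
    rw [← real_inner_self_eq_norm_sq, L2.inner_def]
    refine integral_congr_ae ?_
    filter_upwards [hKc] with p a1
    rw [a1]; simp [sq]
  have hκint : Integrable κ (m.prod m) := hκL.integrable (by norm_num)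
  have hle : ∫ p, κ p ^ 2 ∂(m.prod m) ≤ ∫ p, κ p ∂(m.prod m) :=
    integral_mono hκL.integrable_sq hκint fun p => by nlinarith [h0 p, h1 p]
  obtain ⟨r, hr⟩ : ∃ r : Lp ℝ 2 m, r =ᵐ[m] fun _ => (1:ℝ) :=
    ⟨(memLp_const (1:ℝ)).toLp _, (memLp_const (1:ℝ)).coeFn_toLp⟩
  have hir : ∀ h : Lp ℝ 2 m, (inner ℝ h r : ℝ) = ∫ x, h x ∂m := by
    intro h
    rw [L2.inner_def]
    refine integral_congr_ae ?_
    filter_upwards [hr] with x hx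
    rw [hx]; simp
  have hrr : inner ℝ r r = (1:ℝ) := by
    rw [hir, integral_congr_ae hr]; simp
  have hvr : (inner ℝ (V r) r : ℝ) = ∫ p, κ p ∂(m.prod m) := by
    rw [hV, hKi]
    refine integral_congr_ae ?_
    filter_upwards [ae_fst hr, ae_snd hr] with p a1 a2
    rw [a1, a2]; ring
  have hVs : (V : Lp ℝ 2 m →ₗ[ℝ] Lp ℝ 2 m).IsSymmetric := by
    intro h k
    simp only [ContinuousLinearMap.coe_coe]
    rw [real_inner_comm (V k) h]
    rw [hV, hV, hKi, hKi]
    have e1 := integral_prod_swap (μ := m) (ν := m) (fun p : α × α => κ p * (k p.1 * h p.2))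
    rw [← e1]
    refine integral_congr_ae ?_
    filter_upwards [hsym] with p hp
    rw [hp]; simp [mul_comm]
  have hVr : ∀ h k : Lp ℝ 2 m, (inner ℝ h (V k) : ℝ) = inner ℝ K (ten k h) := by
    intro h k
    rw [real_inner_comm, hV]
  have h3 : (2 / √3) ^ 2 = 4 / 3 := by rw [div_pow, Real.sq_sqrt (by norm_num)]; norm_num
  have h3p : 0 < 2 / √3 := by positivity
  by_cases hV0 : V = 0
  · exfalso
    have hz : ∀ h : Lp ℝ 2 m, ∫ p, κ p * (h p.1 * h p.2) ∂(m.prod m) = 0 := by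
      intro h
      rw [← hKi, ← hV, hV0]; simp
    rw [hz, hz, ← hir, ← hir] at hS
    have hcs := real_inner_mul_inner_self_le f r
    rw [hf, hrr] at hcs
    nlinarith [sq_nonneg (inner ℝ g r : ℝ)]
  obtain ⟨e0, l, he0, hVe0, hl⟩ := compact_eig V (ker_compact K V hV) hVs hV0
  obtain ⟨t, ht⟩ : ∃ t, t = ‖V‖ := ⟨_, rfl⟩
  have hmax : ∀ h : Lp ℝ 2 m, (inner ℝ h (V h) : ℝ) ≤ t * inner ℝ h h := by
    intro h
    refine (real_inner_le_norm _ _).trans ?_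
    rw [real_inner_self_eq_norm_sq, ht]
    nlinarith [V.le_opNorm h, norm_nonneg h]
  obtain ⟨e, he⟩ : ∃ e : Lp ℝ 2 m, e = |e0| := ⟨_, rfl⟩
  have hec : ∀ᵐ x ∂m, e x = |e0 x| := by rw [he]; exact Lp.coeFn_abs e0
  have hen : ∀ᵐ x ∂m, 0 ≤ e x := hec.mono fun x hx => by rw [hx]; exact abs_nonneg _
  have hee : inner ℝ e e = (1:ℝ) := by
    rw [real_inner_self_eq_norm_sq, he, norm_abs_eq_norm, he0]; norm_num
  have het : (inner ℝ e (V e) : ℝ) = t := by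
    refine le_antisymm ?_ ?_
    · have := hmax e
      rwa [hee, mul_one] at this
    · have a1 : (inner ℝ e0 (V e0) : ℝ) = l := by
        rw [hVe0, inner_smul_right, real_inner_self_eq_norm_sq, he0]; ring
      rw [ht, ← hl, ← a1, hVr, hVr, hKi, hKi]
      refine (abs_integral_le_integral_abs).trans (le_of_eq (integral_congr_ae ?_))
      filter_upwards [ae_fst hec, ae_snd hec] with p a1 a2
      rw [a1, a2, abs_mul, abs_mul, abs_of_nonneg (h0 p)]
  have hVe : V e = t • e := max_eig (V : Lp ℝ 2 m →ₗ[ℝ] Lp ℝ 2 m) hVs e t hee hmax het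
  have hte : t ≤ (inner ℝ e r : ℝ) ^ 2 := by
    rw [← het, hVr, hKi, hir, sq, ← integral_prod_mul]
    refine integral_mono_ae (hfIntκ e e) (hfInt e e) ?_
    filter_upwards [ae_fst hen, ae_snd hen] with p a1 a2
    exact mul_le_of_le_one_left (mul_nonneg a1 a2) (h1 p)
  have hmain := abs_case (V : Lp ℝ 2 m →ₗ[ℝ] Lp ℝ 2 m) hVs r e f g t hrr hee hf hg hVe hmax hte
    (by
      intro ι _ b hb
      have := ker_hs K V hV b b hb hb
      simp only [ContinuousLinearMap.coe_coe]
      rw [real_inner_comm, hvr]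
      refine le_trans (le_of_eq ?_) (this.trans (hKK.le.trans hle))
      rw [Finset.sum_comm]
      refine Finset.sum_congr rfl fun i _ => Finset.sum_congr rfl fun j _ => ?_
      rw [real_inner_comm])
    (by
      simp only [ContinuousLinearMap.coe_coe]
      rw [hVr, hVr, hKi, hKi, hir, hir]; exact hS)
  obtain ⟨ht3, hv9⟩ := hmain
  simp only [ContinuousLinearMap.coe_coe] at hv9
  rw [real_inner_comm, hvr] at hv9
  have hKe : (inner ℝ K (ten e e) : ℝ) = 1 / 3 := by rw [← hVr, het, ht3]
  have hsub : ‖K - (1 / 3 : ℝ) • ten e e‖ ^ 2 = ‖K‖ ^ 2 - 1 / 9 := by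
    have hn : ‖ten e e‖ ^ 2 = 1 := by
      rw [← real_inner_self_eq_norm_sq, ten_inner, hee]; norm_num
    rw [norm_sub_sq_real, inner_smul_right, hKe, norm_smul, mul_pow, hn]; norm_num; ring
  have hge : 1 / 9 ≤ ‖K‖ ^ 2 := by nlinarith [sq_nonneg ‖K - (1 / 3 : ℝ) • ten e e‖]
  have hK9 : ‖K‖ ^ 2 = 1 / 9 := le_antisymm (by rw [hKK]; linarith) hge
  rw [hK9, sub_self, sq_eq_zero_iff, norm_eq_zero, sub_eq_zero] at hsub
  refine ⟨e, ?_, hen, hee, hv9, by rw [← hKK, hK9]⟩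
  filter_upwards [hKc, ten_coe e e, Lp.coeFn_smul (1 / 3 : ℝ) (ten e e)] with p a1 a2 a3
  rw [← a1, hsub, a3, Pi.smul_apply, a2, smul_eq_mul]

end kern

open MeasureTheory

lemma push_int (A : Set ℝ) (hA : MeasurableSet A) (a b : ℝ) (hab : a < b)
    (hv : volume A = ENNReal.ofReal (b - a)) :
    ∃ s : ℝ → ℝ, Measurable s ∧ (∀ x, s x ∈ A) ∧
      Measure.map s (volume.restrict (Set.Icc a b)) = volume.restrict A := by
  have hc0 : ENNReal.ofReal (b - a) ≠ 0 := by simpa using hab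
  have hct : ENNReal.ofReal (b - a) ≠ ⊤ := ENNReal.ofReal_ne_top
  have hne : Nonempty A := by
    rw [Set.nonempty_coe_sort]
    by_contra h
    rw [Set.not_nonempty_iff_eq_empty] at h
    rw [h, measure_empty] at hv
    exact hc0 hv.symm
  have : StandardBorelSpace A := hA.standardBorel
  obtain ⟨ν, hν⟩ : ∃ ν : Measure A, ν = (ENNReal.ofReal (b - a))⁻¹ • (volume.comap Subtype.val) :=
    ⟨_, rfl⟩
  have : IsProbabilityMeasure ν := by
    constructor
    rw [hν, Measure.smul_apply, (MeasurableEmbedding.subtype_coe hA).comap_apply]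
    simp [hv]
    exact ENNReal.inv_mul_cancel (by simpa using hab) hct
  obtain ⟨u, hu, huν⟩ := ν.exists_measurable_map_eq
  have hφ : Measurable (fun x : ℝ => (b - a)⁻¹ * (x + -a)) := by fun_prop
  have hproj : Measurable (Set.projIcc (0:ℝ) 1 zero_le_one) := continuous_projIcc.measurable
  have hscale : Measure.map (fun x : ℝ => (b - a)⁻¹ * (x + -a)) (volume.restrict (Set.Icc a b))
      = ENNReal.ofReal (b - a) • volume.restrict (Set.Icc 0 1) := by
    have hpre : (fun x : ℝ => (b - a)⁻¹ * (x + -a)) ⁻¹' (Set.Icc 0 1) = Set.Icc a b := by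
      have hp : 0 < b - a := by linarith
      ext x
      simp only [Set.mem_preimage, Set.mem_Icc]
      rw [inv_mul_eq_div, le_div_iff₀ hp, div_le_iff₀ hp]
      constructor
      · rintro ⟨h1, h2⟩; constructor <;> linarith
      · rintro ⟨h1, h2⟩; constructor <;> linarith
    rw [← hpre, ← Measure.restrict_map hφ measurableSet_Icc]
    have : (fun x : ℝ => (b - a)⁻¹ * (x + -a)) = (fun x => (b - a)⁻¹ * x) ∘ (fun x => x + -a) := rfl
    rw [this, ← Measure.map_map (by fun_prop) (by fun_prop), map_add_right_eq_self,
      Real.map_volume_mul_left (inv_ne_zero (by linarith)), inv_inv, abs_of_pos (by linarith),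
      Measure.restrict_smul]
  have hp : Measure.map (Set.projIcc (0:ℝ) 1 zero_le_one) (volume.restrict (Set.Icc 0 1))
      = (volume : Measure unitInterval) := by
    have h := unitInterval.measurePreserving_coe.map_eq
    change _ = volume.restrict (Set.Icc (0:ℝ) 1) at h
    rw [← h, Measure.map_map hproj measurable_subtype_coe]
    have : (Set.projIcc (0:ℝ) 1 zero_le_one) ∘ (Subtype.val : unitInterval → ℝ) = id := by
      funext x; simp
    rw [this, Measure.map_id]
  refine ⟨fun x => (u (Set.projIcc (0:ℝ) 1 zero_le_one ((b - a)⁻¹ * (x + -a))) : ℝ),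
    measurable_subtype_coe.comp (hu.comp (hproj.comp hφ)), fun x => Subtype.coe_prop _, ?_⟩
  have e1 : (fun x => (u (Set.projIcc (0:ℝ) 1 zero_le_one ((b - a)⁻¹ * (x + -a))) : ℝ))
    = Subtype.val ∘ (u ∘ (Set.projIcc (0:ℝ) 1 zero_le_one ∘ (fun x => (b - a)⁻¹ * (x + -a)))) := rfl
  rw [e1, ← Measure.map_map measurable_subtype_coe (hu.comp (hproj.comp hφ)),
    ← Measure.map_map hu (hproj.comp hφ), ← Measure.map_map hproj hφ, hscale,
    Measure.map_smul, hp, Measure.map_smul, huν, hν, smul_smul,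
    ENNReal.mul_inv_cancel hc0 hct, one_smul, map_comap_subtype_coe hA]

lemma sigma_exists (P : Set ℝ) (hP : MeasurableSet P) (hPI : P ⊆ Set.Icc 0 1)
    (hv : volume P = ENNReal.ofReal (1 / 3)) :
    ∃ σ : ℝ → ℝ, Measurable σ ∧ (∀ x, σ x ∈ Set.Icc (0:ℝ) 1) ∧
      Measure.map σ (volume.restrict (Set.Icc 0 1)) = volume.restrict (Set.Icc 0 1) ∧
      (∀ x, σ x ∈ P ↔ x ∈ Set.Icc (2/3 : ℝ) 1) := by
  have hc : MeasurableSet (Set.Icc (0:ℝ) 1 \ P) := measurableSet_Icc.diff hP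
  have hvc : volume (Set.Icc (0:ℝ) 1 \ P) = ENNReal.ofReal (2 / 3 - 0) := by
    rw [measure_sdiff hPI hP.nullMeasurableSet (by rw [hv]; exact ENNReal.ofReal_ne_top), hv,
      Real.volume_Icc, ← ENNReal.ofReal_sub _ (by norm_num)]
    norm_num
  obtain ⟨s, hs, hsP, hsm⟩ := push_int P hP (2/3) 1 (by norm_num) (by rw [hv]; norm_num)
  obtain ⟨t, ht, htP, htm⟩ := push_int _ hc 0 (2/3) (by norm_num) hvc
  classical
  refine ⟨fun x => if x ∈ Set.Icc (2/3:ℝ) 1 then s x else t x,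
    Measurable.ite measurableSet_Icc hs ht, ?_, ?_, ?_⟩
  · intro x
    simp only
    split_ifs
    · exact hPI (hsP x)
    · exact (htP x).1
  · have hm : Measurable (fun x => if x ∈ Set.Icc (2/3:ℝ) 1 then s x else t x) :=
      Measurable.ite measurableSet_Icc hs ht
    have hun : Set.Icc (0:ℝ) 1 = Set.Ico 0 (2/3) ∪ Set.Icc (2/3) 1 :=
      (Set.Ico_union_Icc_eq_Icc (by norm_num) (by norm_num)).symm
    have hd : Disjoint (Set.Ico (0:ℝ) (2/3)) (Set.Icc (2/3) 1) := by
      rw [Set.disjoint_left]; intro x h1 h2; exact absurd h2.1 (not_le.2 h1.2)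
    conv_lhs => rw [hun, Measure.restrict_union hd measurableSet_Icc]
    rw [Measure.map_add _ _ hm]
    have e1 : Measure.map (fun x => if x ∈ Set.Icc (2/3:ℝ) 1 then s x else t x)
        (volume.restrict (Set.Icc (2/3) 1)) = volume.restrict P := by
      rw [← hsm]
      refine Measure.map_congr ?_
      filter_upwards [ae_restrict_mem measurableSet_Icc] with x hx
      exact if_pos hx
    have e2 : Measure.map (fun x => if x ∈ Set.Icc (2/3:ℝ) 1 then s x else t x)
        (volume.restrict (Set.Ico 0 (2/3))) = volume.restrict (Set.Icc (0:ℝ) 1 \ P) := by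
      rw [← htm, ← Measure.restrict_congr_set (Ico_ae_eq_Icc (μ := volume) (a := (0:ℝ)) (b := 2/3))]
      refine Measure.map_congr ?_
      filter_upwards [ae_restrict_mem measurableSet_Ico] with x hx
      exact if_neg fun h => absurd h.1 (not_le.2 hx.2)
    rw [e1, e2, ← Measure.restrict_union Set.disjoint_sdiff_left hP, Set.sdiff_union_of_subset hPI]
  · intro x
    simp only
    split_ifs with h
    · exact ⟨fun _ => h, fun _ => hsP x⟩
    · exact ⟨fun h' => absurd h' (htP x).2, fun h' => absurd h' h⟩

open MeasureTheory

lemma kern_set {α : Type*} [MeasurableSpace α] {m : Measure α} [IsProbabilityMeasure m]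
    (κ : α × α → ℝ) (hκm : Measurable κ) (h0 : ∀ p, 0 ≤ κ p) (h1 : ∀ p, κ p ≤ 1)
    (hsym : ∀ᵐ p ∂(m.prod m), κ p = κ p.swap) (f g : Lp ℝ 2 m) (hf : inner ℝ f f = (1:ℝ))
    (hg : inner ℝ g g = (1:ℝ))
    (hS : 2 / √3 ≤ ((∫ x, f x ∂m) ^ 2 - ∫ p, κ p * (f p.1 * f p.2) ∂(m.prod m))
      - ((∫ x, g x ∂m) ^ 2 - ∫ p, κ p * (g p.1 * g p.2) ∂(m.prod m))) :
    ∃ P : Set α, MeasurableSet P ∧ m P = ENNReal.ofReal (1 / 3) ∧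
      ∀ᵐ p ∂(m.prod m), (p.1 ∈ P ∧ p.2 ∈ P → κ p = 1) ∧ (¬ (p.1 ∈ P ∧ p.2 ∈ P) → κ p = 0) := by
  obtain ⟨e, hke, he0, hee, hi1, hi2⟩ := kern_main κ hκm h0 h1 hsym f g hf hg hS
  have hκL : MemLp κ 2 (m.prod m) := MemLp.of_bound hκm.aestronglyMeasurable 1
    (Filter.Eventually.of_forall fun p => by rw [Real.norm_eq_abs, abs_of_nonneg (h0 p)]; exact h1 p)
  have hκint : Integrable κ (m.prod m) := hκL.integrable (by norm_num)
  have hz : ∫ p, (κ p - κ p ^ 2) ∂(m.prod m) = 0 := by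
    rw [integral_sub hκint hκL.integrable_sq, hi1, hi2, sub_self]
  have hz' := (integral_eq_zero_iff_of_nonneg
    (fun p => by have := h0 p; have := h1 p; simp only [Pi.zero_apply, Pi.sub_apply]; nlinarith)
    (hκint.sub hκL.integrable_sq)).1 hz
  have hesq : ∫ x, e x ^ 2 ∂m = 1 := by
    rw [← hee, L2.inner_def]
    refine integral_congr_ae (Filter.Eventually.of_forall fun x => ?_)
    simp [sq]
  have heint : Integrable (fun x => e x) m := (Lp.memLp e).integrable (by norm_num)
  have hesqint : Integrable (fun x => e x ^ 2) m := (Lp.memLp e).integrable_sq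
  have hE2 : (∫ x, e x ∂m) ^ 2 = 1 / 3 := by
    have : ∫ p, κ p ∂(m.prod m) = 1 / 3 * (∫ x, e x ∂m) ^ 2 := by
      rw [integral_congr_ae hke, integral_const_mul, integral_prod_mul, sq]
    rw [hi1] at this; linarith
  have hE0 : 0 ≤ ∫ x, e x ∂m := integral_nonneg_of_ae he0
  obtain ⟨s, hs⟩ : ∃ s, s = 3 * ∫ x, e x ∂m := ⟨_, rfl⟩
  have hs2 : s ^ 2 = 3 := by rw [hs, mul_pow, hE2]; norm_num
  have hs0 : s ≠ 0 := by rintro rfl; norm_num at hs2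
  have hdich : ∀ᵐ x ∂m, e x = 0 ∨ e x = s := by
    have hpr : ∀ᵐ p ∂(m.prod m), 3 * e p.1 * e p.2 = e p.1 ^ 2 * e p.2 ^ 2 := by
      filter_upwards [hz', hke] with p a1 a2
      simp only [Pi.zero_apply, Pi.sub_apply] at a1
      rw [a2] at a1
      nlinarith
    filter_upwards [Measure.ae_ae_of_ae_prod hpr] with x hx
    have hi := integral_congr_ae hx
    rw [integral_const_mul, integral_const_mul, hesq] at hi
    have : e x * (e x - s) = 0 := by rw [hs]; linarith
    rcases mul_eq_zero.1 this with h | h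
    · exact Or.inl h
    · exact Or.inr (by linarith)
  have hPm : MeasurableSet {x | e x = s} :=
    (Lp.stronglyMeasurable e).measurable (measurableSet_singleton s)
  refine ⟨{x | e x = s}, hPm, ?_, ?_⟩
  · have h2 : ∫ x, e x ^ 2 ∂m = ∫ x, Set.indicator {x | e x = s} (fun _ => (3:ℝ)) x ∂m := by
      refine integral_congr_ae ?_
      filter_upwards [hdich] with x hx
      by_cases h : e x = s
      · rw [Set.indicator_of_mem (show x ∈ {x | e x = s} from h), h, hs2]
      · rw [Set.indicator_of_notMem (show x ∉ {x | e x = s} from h), hx.resolve_right h]; norm_num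
    rw [hesq, integral_indicator hPm, setIntegral_const, smul_eq_mul] at h2
    rw [← ofReal_measureReal]
    congr 1
    linarith
  · filter_upwards [hke, ae_fst hdich, ae_snd hdich] with p a1 a2 a3
    constructor
    · rintro ⟨b1, b2⟩
      change e p.1 = s at b1
      change e p.2 = s at b2
      rw [a1, b1, b2]; linarith
    · intro hn
      rw [a1]
      rcases a2 with b | b
      · rw [b]; ring
      · rcases a3 with c | c
        · rw [c]; ring
        · exact absurd ⟨b, c⟩ hn

lemma unitSq_eq : unitSq = unitInt.prod unitInt := by
  rw [unitSq, unitInt, Measure.prod_restrict, Measure.volume_eq_prod]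

lemma unitInt_prob : IsProbabilityMeasure unitInt := by
  constructor
  rw [unitInt, Measure.restrict_apply_univ, Real.volume_Icc]
  norm_num

lemma unit_memLp (f : ℝ → ℝ) (hf : IsUnitL2 f) : MemLp f 2 unitInt := by
  refine (memLp_two_iff_integrable_sq hf.1.aestronglyMeasurable).2 ?_
  by_contra h
  have h1 := hf.2
  have h2 := integral_undef h
  rw [unitInt] at h2
  rw [h2] at h1
  exact zero_ne_one h1

lemma quad_facts {m : Measure ℝ} [IsProbabilityMeasure m] (κ : ℝ × ℝ → ℝ) (hκm : Measurable κ)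
    (h0 : ∀ p, 0 ≤ κ p) (h1 : ∀ p, κ p ≤ 1) (f : ℝ → ℝ) (hf : MemLp f 2 m)
    (hfi : ∫ x, f x ^ 2 ∂m = 1) :
    ∃ F : Lp ℝ 2 m, inner ℝ F F = (1:ℝ) ∧
      Integrable (fun p : ℝ × ℝ => (1 - κ p) * (f p.1 * f p.2)) (m.prod m) ∧
      ∫ p, (1 - κ p) * (f p.1 * f p.2) ∂(m.prod m)
        = (∫ x, F x ∂m) ^ 2 - ∫ p, κ p * (F p.1 * F p.2) ∂(m.prod m) := by
  have hc := hf.coeFn_toLp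
  have hfInt : Integrable (fun p : ℝ × ℝ => f p.1 * f p.2) (m.prod m) :=
    (hf.integrable (by norm_num)).mul_prod (hf.integrable (by norm_num))
  have hfIntκ : Integrable (fun p : ℝ × ℝ => κ p * (f p.1 * f p.2)) (m.prod m) :=
    hfInt.bdd_mul (c := 1) hκm.aestronglyMeasurable
      (Filter.Eventually.of_forall fun p => by rw [Real.norm_eq_abs, abs_of_nonneg (h0 p)]; exact h1 p)
  have hsplit : (fun p : ℝ × ℝ => (1 - κ p) * (f p.1 * f p.2))
      = fun p => f p.1 * f p.2 - κ p * (f p.1 * f p.2) := by funext p; ring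
  refine ⟨hf.toLp f, ?_, ?_, ?_⟩
  · rw [L2.inner_def, ← hfi]
    refine integral_congr_ae ?_
    filter_upwards [hc] with x hx
    rw [hx]; simp [sq]
  · rw [hsplit]; exact hfInt.sub hfIntκ
  · rw [hsplit, integral_sub hfInt hfIntκ, integral_prod_mul, ← sq, integral_congr_ae hc]
    congr 1
    refine integral_congr_ae ?_
    filter_upwards [ae_fst hc, ae_snd hc] with p a1 a2
    rw [a1, a2]

/-- Equality case: if a graphon `W` attains `⟨f, A_W f⟩ − ⟨g, A_W g⟩ = 2/√3` for unit
`f, g ∈ L²[0,1]`, then, up to a measure-preserving transformation of `[0,1]`,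
`W` is `0` on `[2/3,1]²` and `1` elsewhere (almost everywhere). -/
theorem graphon_spread_eq (W : ℝ → ℝ → ℝ) (hW : IsGraphon W)
    (f g : ℝ → ℝ) (hf : IsUnitL2 f) (hg : IsUnitL2 g)
    (heq : (∫ x in Set.Icc (0 : ℝ) 1, ∫ y in Set.Icc (0 : ℝ) 1,
      W x y * (f x * f y - g x * g y)) = 2 / Real.sqrt 3) :
    ∃ σ : ℝ → ℝ, Set.MapsTo σ (Set.Icc (0 : ℝ) 1) (Set.Icc (0 : ℝ) 1) ∧
      MeasurePreserving σ unitInt unitInt ∧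
      (∀ᵐ p : ℝ × ℝ ∂unitSq,
        (p ∈ Set.Icc (2/3 : ℝ) 1 ×ˢ Set.Icc (2/3 : ℝ) 1 → W (σ p.1) (σ p.2) = 0) ∧
        (p ∉ Set.Icc (2/3 : ℝ) 1 ×ˢ Set.Icc (2/3 : ℝ) 1 → W (σ p.1) (σ p.2) = 1)) := by
  have hprob : IsProbabilityMeasure unitInt := unitInt_prob
  obtain ⟨hWm, hWI, hWs⟩ := hW
  have hκm : Measurable (fun p : ℝ × ℝ => 1 - W p.1 p.2) := measurable_const.sub hWm
  have h0 : ∀ p : ℝ × ℝ, 0 ≤ 1 - W p.1 p.2 := fun p => by linarith [(hWI p.1 p.2).2]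
  have h1 : ∀ p : ℝ × ℝ, 1 - W p.1 p.2 ≤ 1 := fun p => by linarith [(hWI p.1 p.2).1]
  obtain ⟨F, hF, hFi, hFq⟩ := quad_facts (fun p : ℝ × ℝ => 1 - W p.1 p.2) hκm h0 h1 f
    (unit_memLp f hf) hf.2
  obtain ⟨G, hG, hGi, hGq⟩ := quad_facts (fun p : ℝ × ℝ => 1 - W p.1 p.2) hκm h0 h1 g
    (unit_memLp g hg) hg.2
  have hsym : ∀ᵐ p ∂(unitInt.prod unitInt), (fun p : ℝ × ℝ => 1 - W p.1 p.2) p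
      = (fun p : ℝ × ℝ => 1 - W p.1 p.2) p.swap := by
    rw [unitSq_eq] at hWs
    filter_upwards [hWs] with p hp
    simp [hp]
  have hS : 2 / √3 = (∫ p, (1 - (1 - W p.1 p.2)) * (f p.1 * f p.2) ∂(unitInt.prod unitInt))
      - ∫ p, (1 - (1 - W p.1 p.2)) * (g p.1 * g p.2) ∂(unitInt.prod unitInt) := by
    rw [← integral_sub hFi hGi, ← heq]
    refine Eq.trans ?_ (integral_prod _ (hFi.sub hGi)).symm
    refine integral_congr_ae (Filter.Eventually.of_forall fun x => ?_)
    refine integral_congr_ae (Filter.Eventually.of_forall fun y => ?_)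
    simp only [Pi.sub_apply]
    ring
  rw [hFq, hGq] at hS
  obtain ⟨P, hPm, hPv, hP⟩ := kern_set _ hκm h0 h1 hsym F G hF hG hS.le
  obtain ⟨σ, hσm, hσI, hσmap, hσP⟩ := sigma_exists (P ∩ Set.Icc 0 1)
    (hPm.inter measurableSet_Icc) Set.inter_subset_right
    (by rw [← hPv, unitInt, Measure.restrict_apply hPm])
  have hmp : MeasurePreserving σ unitInt unitInt := ⟨hσm, hσmap⟩
  refine ⟨σ, fun x _ => hσI x, hmp, ?_⟩
  rw [unitSq_eq]
  have hiff : ∀ x, σ x ∈ P ↔ x ∈ Set.Icc (2/3 : ℝ) 1 := fun x =>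
    ⟨fun h => (hσP x).1 ⟨h, hσI x⟩, fun h => ((hσP x).2 h).1⟩
  filter_upwards [(hmp.prod hmp).quasiMeasurePreserving.ae hP] with p hp
  simp only [Prod.map_fst, Prod.map_snd, hiff] at hp
  constructor
  · intro h
    have := hp.1 ⟨h.1, h.2⟩
    linarith
  · intro h
    have := hp.2 (fun h' => h ⟨h'.1, h'.2⟩)
    linarith
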